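/- arXiv:2409.17098 — 4 statements merged into one kernel-verified Lean document; each statement's English description precedes it below -/
import Mathlib

section
/- There exists an absolute constant C such that for every natural number n > C, the minimum number μ₅(n) of 5-element subsets in convex position over all point placements of n points satisfies μ₅(n) ≥ ((5·√5 − 11)/480)·n⁵. -/
open Finset

/-- A finite set of points in the plane is in *general position* if no three of
its points are collinear. -/
def GenPos (P : Finset (ℝ × ℝ)) : Prop :=
  ∀ x ∈ P, ∀ y ∈ P, ∀ z ∈ P, x ≠ y → x ≠ z → y ≠ z →
    ¬ Collinear ℝ ({x, y, z} : Set (ℝ × ℝ))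

/-- A finite set of points is in *convex position* if every point of it is an
extreme point of its convex hull. -/
def ConvexPos (S : Finset (ℝ × ℝ)) : Prop :=
  ∀ x ∈ S, x ∈ Set.extremePoints ℝ (convexHull ℝ (S : Set (ℝ × ℝ)))

open scoped Classical in
/-- Number of `k`-element subsets of `P` that are in convex position. -/
noncomputable def convexPosCount (P : Finset (ℝ × ℝ)) (k : ℕ) : ℕ :=
  ((P.powersetCard k).filter fun S => ConvexPos S).card

/-- `mu k n` is the minimum number of `k`-element subsets in convex position over
all placements of `n` points in general position. -/
noncomputable def mu (k n : ℕ) : ℕ :=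
  sInf {m | ∃ P : Finset (ℝ × ℝ), GenPos P ∧ P.card = n ∧ convexPosCount P k = m}

/-- `x` is a γ-point of `T` if `T ∪ {x}` is in convex position. -/
def IsGammaPt (T : Finset (ℝ × ℝ)) (x : ℝ × ℝ) : Prop :=
  ConvexPos (insert x T)

/-- `x` is a β-point of `T` if `T ∪ {x}` is not in convex position and `x` does not
lie in the convex hull of `T`. -/
def IsBetaPt (T : Finset (ℝ × ℝ)) (x : ℝ × ℝ) : Prop :=
  ¬ ConvexPos (insert x T) ∧ x ∉ convexHull ℝ (T : Set (ℝ × ℝ))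

open scoped Classical in
/-- `γ_T`: number of γ-points of `T` among the points of `P \ T`. -/
noncomputable def gammaCount (P T : Finset (ℝ × ℝ)) : ℕ :=
  ((P \ T).filter fun x => IsGammaPt T x).card

open scoped Classical in
/-- `β_T`: number of β-points of `T` among the points of `P \ T`. -/
noncomputable def betaCount (P T : Finset (ℝ × ℝ)) : ℕ :=
  ((P \ T).filter fun x => IsBetaPt T x).card

open scoped Classical in
/-- Number of `k`-element subsets of `P` whose convex hull has exactly `j`
extreme points. -/
noncomputable def hullCount (P : Finset (ℝ × ℝ)) (k j : ℕ) : ℕ :=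
  ((P.powersetCard k).filter fun S =>
    (Set.extremePoints ℝ (convexHull ℝ (S : Set (ℝ × ℝ)))).ncard = j).card

/-- `x` and `y` lie strictly on the same side of the line through `p` and `q`. -/
def SameSide (p q x y : ℝ × ℝ) : Prop :=
  0 < ((q.1 - p.1) * (x.2 - p.2) - (q.2 - p.2) * (x.1 - p.1)) *
      ((q.1 - p.1) * (y.2 - p.2) - (q.2 - p.2) * (y.1 - p.1))

/-- `x` and `y` lie in the same region with respect to `T`: for each pair of
distinct points of `T`, they lie strictly on the same side of the line through them. -/
def SameRegion (T : Finset (ℝ × ℝ)) (x y : ℝ × ℝ) : Prop :=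
  ∀ p ∈ T, ∀ q ∈ T, p ≠ q → SameSide p q x y

open scoped Classical in
/-- Number of 2-element subsets `{x, y}` of `P \ T` such that `x` and `y` are both
γ-points of `T` lying in the same region with respect to `T`. -/
noncomputable def gammaSamePairs (P T : Finset (ℝ × ℝ)) : ℕ :=
  (((P \ T).powersetCard 2).filter fun S =>
    (∀ x ∈ S, IsGammaPt T x) ∧ ∀ x ∈ S, ∀ y ∈ S, x ≠ y → SameRegion T x y).card

open scoped Classical in
/-- Number of 2-element subsets `{x, y}` of `P \ T` such that `x` and `y` are both
γ-points of `T` lying in distinct regions with respect to `T`. -/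
noncomputable def gammaDiffPairs (P T : Finset (ℝ × ℝ)) : ℕ :=
  (((P \ T).powersetCard 2).filter fun S =>
    (∀ x ∈ S, IsGammaPt T x) ∧ ∀ x ∈ S, ∀ y ∈ S, x ≠ y → ¬ SameRegion T x y).card

open scoped Classical in
/-- Number of 2-element subsets `{x, y}` of `P \ T` such that `x` and `y` are both
β-points of `T` lying in the same region with respect to `T`. -/
noncomputable def betaSamePairs (P T : Finset (ℝ × ℝ)) : ℕ :=
  (((P \ T).powersetCard 2).filter fun S =>
    (∀ x ∈ S, IsBetaPt T x) ∧ ∀ x ∈ S, ∀ y ∈ S, x ≠ y → SameRegion T x y).card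

open scoped Classical in
/-- Number of 2-element subsets `{x, y}` of `P \ T` such that `x` and `y` are both
β-points of `T` lying in distinct regions with respect to `T`. -/
noncomputable def betaDiffPairs (P T : Finset (ℝ × ℝ)) : ℕ :=
  (((P \ T).powersetCard 2).filter fun S =>
    (∀ x ∈ S, IsBetaPt T x) ∧ ∀ x ∈ S, ∀ y ∈ S, x ≠ y → ¬ SameRegion T x y).card

/-- Packed table of the weights: the entry with index `i < 512` occupies the seven binary digits
starting at place `7 * i`, and stands for itself minus `64`. -/
def weightTable : ℕ :=
  2922944735117670914840286456373443716738541541921697072075571269844562790859426774051115514454795006908448422123098238413604244793745515656165672108714161500221633887648421376597132885724755922846108533683406567231460204238365622117639039648818180371382844767656774421586838281486667205159219227708010088785785504034241379476553158125703773597027096736291514967262471210559073563371234709761831371616039873398613850780536192553885217096346445696203312632781819793853142813239856972628243381751069089369574261893959278608648697966337190614457489213001353735437282570471623452527424783822749813160400208185288639645629872070282310638992338612408653678489950555874691165545848807873918725839996198458397965344707295029615721511089268678699929807197979946067899912013927423397669197727212916960605866559491428855495297732198132762840069673255770961469568974495293575323426633130026148873699005690133270749221298489395333208466392109679829535749156286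38692168737627806167014475148040421601016558952773423705508478190142464116288964311635345165180726375857958481065929573542863568896

/-- Reads an entry of `weightTable` from the three octal digits of its index. -/
def weightEntry (s t r : ℕ) : ℕ :=
  weightTable / 2 ^ (7 * (64 * s + 8 * t + r)) % 128

/-- The octal digit recording which of `p`, `q`, `r` agree with `s`. -/
def agreeDigit (s p q r : Bool) : ℕ :=
  cond (xor s p) 0 4 + cond (xor s q) 0 2 + cond (xor s r) 0 1

/-- The product `(v - 64) * (w - 64)`, shifted by `12160` to make it nonnegative. -/
def shiftedMul (v w : ℕ) : ℕ :=
  v * w + 64 * (254 - (v + w))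

/-- The three shifted products of weights with a fixed base triangle `abc` and the three remaining
points `d`, `x`, `y` of a 6-point configuration, as a function of the octal digits. -/
def blockOfDigits (d x y dx dy xy : ℕ) : ℕ :=
  shiftedMul (weightEntry d x dx) (weightEntry d y dy) +
  shiftedMul (weightEntry x d (7 - dx)) (weightEntry x y xy) +
  shiftedMul (weightEntry y d (7 - dy)) (weightEntry y x (7 - xy))

/-- `blockOfDigits` as a function of the orientations of the triples meeting the base triangle
in at least one point. -/
def block (abc abd bcd cad abx bcx cax aby bcy cay adx bdx cdx ady bdy cdy axy bxy cxy : Bool) : ℕ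
    :=
  blockOfDigits (agreeDigit abc abd bcd cad) (agreeDigit abc abx bcx cax)
    (agreeDigit abc aby bcy cay) (agreeDigit abc adx bdx cdx) (agreeDigit abc ady bdy cdy)
    (agreeDigit abc axy bxy cxy)

/-- The signotope condition: the sequence of orientations `abc, abd, acd, bcd` of four points sorted
lexicographically changes at most once. -/
def monoSigns (p q r s : Bool) : Bool :=
  not (cond (xor p q) (xor q r || xor r s) (xor q r && xor r s))

/-- The convexity criterion for four sorted points, in terms of `abc, abd, acd, bcd`. -/
def convexSigns (p q r s : Bool) : Bool :=
  p == q && r == s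

/-- Conjunction over both truth values. -/
def forallBool (f : Bool → Bool) : Bool := f true && f false

theorem forallBool_eq_true {f : Bool → Bool} : forallBool f = true ↔ ∀ b, f b = true := by
  simp [forallBool, and_comm]

theorem cond_true_eq_true {p q : Bool} : cond p q true = true ↔ (p = true → q = true) := by
  cases p <;> simp

/-- Convexity of five sorted points, in terms of the orientations of the triples. -/
def convexSigns₅ (p012 p013 p023 p123 p014 p024 p124 p034 p134 p234 : Bool) : Bool :=
  convexSigns p012 p013 p023 p123 && convexSigns p012 p014 p024 p124 &&
  convexSigns p013 p014 p034 p134 && convexSigns p023 p024 p034 p234 &&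
  convexSigns p123 p124 p134 p234

/-- Sum of the sixty shifted products of weights of a 6-point configuration. -/
def blockSum
    (b012 b013 b023 b123 b014 b024 b124 b034 b134 b234 b015 b025 b125 b035 b135 b235 b045 b145
     b245 b345 : Bool) :
    ℕ :=
  block b012 b013 b123 (!b023) b014 b124 (!b024) b015 b125 (!b025) b034 b134 b234 b035 b135 b235
      b045 b145 b245 +
  block b013 b012 (!b123) b023 b014 b134 (!b034) b015 b135 (!b035) b024 b124 (!b234) b025 b125
      (!b235) b045 b145 b345 +
  block b014 b012 (!b124) b024 b013 (!b134) b034 b015 b145 (!b045) b023 b123 b234 b025 b125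
      (!b245) b035 b135 (!b345) +
  block b015 b012 (!b125) b025 b013 (!b135) b035 b014 (!b145) b045 b023 b123 b235 b024 b124 b245
      b034 b134 b345 +
  block b023 (!b012) b123 b013 b024 b234 (!b034) b025 b235 (!b035) b014 (!b124) (!b134) b015
      (!b125) (!b135) b045 b245 b345 +
  block b024 (!b012) b124 b014 b023 (!b234) b034 b025 b245 (!b045) b013 (!b123) b134 b015 (!b125)
      (!b145) b035 b235 (!b345) +
  block b025 (!b012) b125 b015 b023 (!b235) b035 b024 (!b245) b045 b013 (!b123) b135 b014 (!b124)
      b145 b034 b234 b345 +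
  block b034 (!b013) b134 b014 (!b023) b234 b024 b035 b345 (!b045) b012 b123 b124 b015 (!b135)
      (!b145) b025 (!b235) (!b245) +
  block b035 (!b013) b135 b015 (!b023) b235 b025 b034 (!b345) b045 b012 b123 b125 b014 (!b134)
      b145 b024 (!b234) b245 +
  block b045 (!b014) b145 b015 (!b024) b245 b025 (!b034) b345 b035 b012 b124 b125 b013 b134 b135
      b023 b234 b235 +
  block b123 b012 b023 (!b013) b124 b234 (!b134) b125 b235 (!b135) (!b014) (!b024) (!b034) (!b015)
      (!b025) (!b035) b145 b245 b345 +
  block b124 b012 b024 (!b014) b123 (!b234) b134 b125 b245 (!b145) (!b013) (!b023) b034 (!b015)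
      (!b025) (!b045) b135 b235 (!b345) +
  block b125 b012 b025 (!b015) b123 (!b235) b135 b124 (!b245) b145 (!b013) (!b023) b035 (!b014)
      (!b024) b045 b134 b234 b345 +
  block b134 b013 b034 (!b014) (!b123) b234 b124 b135 b345 (!b145) (!b012) b023 b024 (!b015)
      (!b035) (!b045) b125 (!b235) (!b245) +
  block b135 b013 b035 (!b015) (!b123) b235 b125 b134 (!b345) b145 (!b012) b023 b025 (!b014)
      (!b034) b045 b124 (!b234) b245 +
  block b145 b014 b045 (!b015) (!b124) b245 b125 (!b134) b345 b135 (!b012) b024 b025 (!b013) b034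
      b035 b123 b234 b235 +
  block b234 b023 b034 (!b024) b123 b134 (!b124) b235 b345 (!b245) b012 b013 b014 (!b025) (!b035)
      (!b045) (!b125) (!b135) (!b145) +
  block b235 b023 b035 (!b025) b123 b135 (!b125) b234 (!b345) b245 b012 b013 b015 (!b024) (!b034)
      b045 (!b124) (!b134) b145 +
  block b245 b024 b045 (!b025) b124 b145 (!b125) (!b234) b345 b235 b012 b014 b015 (!b023) b034
      b035 (!b123) b134 b135 +
  block b345 b034 b045 (!b035) b134 b145 (!b135) b234 b245 (!b235) b013 b014 b015 b023 b024 b025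
      b123 b124 b125

/-- Number of convex 5-subsets of a 6-point configuration. -/
def convexCount₆
    (b012 b013 b023 b123 b014 b024 b124 b034 b134 b234 b015 b025 b125 b035 b135 b235 b045 b145
     b245 b345 : Bool) :
    ℕ :=
  (convexSigns₅ b123 b124 b134 b234 b125 b135 b235 b145 b245 b345).toNat +
  (convexSigns₅ b023 b024 b034 b234 b025 b035 b235 b045 b245 b345).toNat +
  (convexSigns₅ b013 b014 b034 b134 b015 b035 b135 b045 b145 b345).toNat +
  (convexSigns₅ b012 b014 b024 b124 b015 b025 b125 b045 b145 b245).toNat +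
  (convexSigns₅ b012 b013 b023 b123 b015 b025 b125 b035 b135 b235).toNat +
  (convexSigns₅ b012 b013 b023 b123 b014 b024 b124 b034 b134 b234).toNat

/-- The local inequality for a 6-point configuration. -/
def localBound
    (b012 b013 b023 b123 b014 b024 b124 b034 b134 b234 b015 b025 b125 b035 b135 b235 b045 b145
     b245 b345 : Bool) :
    Bool :=
  Nat.ble
    (blockSum
      b012 b013 b023 b123 b014 b024 b124 b034 b134 b234 b015 b025 b125 b035 b135 b235 b045 b145
      b245 b345 + 5740)
    (21000 * convexCount₆
      b012 b013 b023 b123 b014 b024 b124 b034 b134 b234 b015 b025 b125 b035 b135 b235 b045 b145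
      b245 b345 + 729600)

/-- The local inequality for all 6-point configurations satisfying the signotope condition. -/
def localBoundCheck : Bool :=
  forallBool fun b012 => forallBool fun b013 => forallBool fun b023 => forallBool fun b123 =>
  cond (monoSigns b012 b013 b023 b123) (forallBool fun b014 => forallBool fun b024 =>
  forallBool fun b124 => cond (monoSigns b012 b014 b024 b124) (forallBool fun b034 =>
  forallBool fun b134 => cond (monoSigns b013 b014 b034 b134) (forallBool fun b234 =>
  cond (monoSigns b023 b024 b034 b234) (cond (monoSigns b123 b124 b134 b234) (
  forallBool fun b015 => forallBool fun b025 => forallBool fun b125 =>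
  cond (monoSigns b012 b015 b025 b125) (forallBool fun b035 => forallBool fun b135 =>
  cond (monoSigns b013 b015 b035 b135) (forallBool fun b235 =>
  cond (monoSigns b023 b025 b035 b235) (cond (monoSigns b123 b125 b135 b235) (
  forallBool fun b045 => forallBool fun b145 => cond (monoSigns b014 b015 b045 b145) (
  forallBool fun b245 => cond (monoSigns b024 b025 b045 b245) (
  cond (monoSigns b124 b125 b145 b245) (forallBool fun b345 =>
  cond (monoSigns b034 b035 b045 b345) (cond (monoSigns b134 b135 b145 b345) (
  cond (monoSigns b234 b235 b245 b345) (
    localBound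
      b012 b013 b023 b123 b014 b024 b124 b034 b134 b234 b015 b025 b125 b035 b135 b235 b045 b145
      b245 b345) true) true) true) true) true) true) true) true) true) true) true) true) true)
          true) true

theorem localBoundCheck_eq_true : localBoundCheck = true := by
  decide +kernel

theorem localBound_eq_true
    {b012 b013 b023 b123 b014 b024 b124 b034 b134 b234 b015 b025 b125 b035 b135 b235 b045 b145
    b245 b345 : Bool}
    (h0123 : monoSigns b012 b013 b023 b123 = true) (h0124 : monoSigns b012 b014 b024 b124 = true)
    (h0134 : monoSigns b013 b014 b034 b134 = true) (h0234 : monoSigns b023 b024 b034 b234 = true)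
    (h1234 : monoSigns b123 b124 b134 b234 = true) (h0125 : monoSigns b012 b015 b025 b125 = true)
    (h0135 : monoSigns b013 b015 b035 b135 = true) (h0235 : monoSigns b023 b025 b035 b235 = true)
    (h1235 : monoSigns b123 b125 b135 b235 = true) (h0145 : monoSigns b014 b015 b045 b145 = true)
    (h0245 : monoSigns b024 b025 b045 b245 = true) (h1245 : monoSigns b124 b125 b145 b245 = true)
    (h0345 : monoSigns b034 b035 b045 b345 = true) (h1345 : monoSigns b134 b135 b145 b345 = true)
    (h2345 : monoSigns b234 b235 b245 b345 = true) :
    localBound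
      b012 b013 b023 b123 b014 b024 b124 b034 b134 b234 b015 b025 b125 b035 b135 b235 b045 b145
      b245 b345 = true := by
  have h := localBoundCheck_eq_true
  simp only [localBoundCheck, forallBool_eq_true, cond_true_eq_true] at h
  exact h
    b012 b013 b023 b123 h0123 b014 b024 b124 h0124 b034 b134 h0134 b234 h0234 h1234 b015 b025
    b125 h0125 b035 b135 h0135 b235 h0235 h1235 b045 b145 h0145 b245 h0245 h1245 b345 h0345 h1345
    h2345

/-- An orientation of the triples of a linear order which is alternating and satisfies the signotope
condition. -/
structure IsSignotope {α : Type*} [LinearOrder α] (o : α → α → α → Bool) : Prop where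
  swap_right : ∀ i j k, i ≠ j → i ≠ k → j ≠ k → o i k j = !o i j k
  swap_left : ∀ i j k, i ≠ j → i ≠ k → j ≠ k → o j i k = !o i j k
  mono : ∀ i j k l, i < j → j < k → k < l →
    monoSigns (o i j k) (o i j l) (o i k l) (o j k l) = true

theorem IsSignotope.comp {α β : Type*} [LinearOrder α] [LinearOrder β] {o : β → β → β → Bool}
    (ho : IsSignotope o) (e : α ↪o β) : IsSignotope fun i j k => o (e i) (e j) (e k) where
  swap_right _ _ _ h₁ h₂ h₃ := ho.swap_right _ _ _ (e.injective.ne h₁) (e.injective.ne h₂)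
    (e.injective.ne h₃)
  swap_left _ _ _ h₁ h₂ h₃ := ho.swap_left _ _ _ (e.injective.ne h₁) (e.injective.ne h₂)
    (e.injective.ne h₃)
  mono _ _ _ _ h₁ h₂ h₃ := ho.mono _ _ _ _ (e.lt_iff_lt.2 h₁) (e.lt_iff_lt.2 h₂) (e.lt_iff_lt.2 h₃)

/-- The weight of the point `x` with respect to the triangle `abc` and the point `d`. -/
def weight {α : Type*} (o : α → α → α → Bool) (a b c d x : α) : ℤ :=
  weightEntry (agreeDigit (o a b c) (o a b d) (o b c d) (o c a d))
    (agreeDigit (o a b c) (o a b x) (o b c x) (o c a x))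
    (agreeDigit (o a b c) (o a d x) (o b d x) (o c d x)) - 64

theorem weightEntry_lt (s t r : ℕ) : weightEntry s t r < 128 :=
  Nat.mod_lt _ (by norm_num)

theorem weight_sq_le {α : Type*} (o : α → α → α → Bool) (a b c d x : α) :
    weight o a b c d x ^ 2 ≤ 4096 := by
  have h := weightEntry_lt (agreeDigit (o a b c) (o a b d) (o b c d) (o c a d))
    (agreeDigit (o a b c) (o a b x) (o b c x) (o c a x))
    (agreeDigit (o a b c) (o a d x) (o b d x) (o c d x))
  unfold weight
  zify at h
  nlinarith

theorem shiftedMul_eq {v w : ℕ} (hv : v < 128) (hw : w < 128) :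
    (shiftedMul v w : ℤ) = (v - 64) * (w - 64) + 12160 := by
  unfold shiftedMul
  push_cast [show v + w ≤ 254 by omega]
  ring

theorem agreeDigit_not (s p q r : Bool) : agreeDigit s (!p) (!q) (!r) = 7 - agreeDigit s p q r := by
  cases s <;> cases p <;> cases q <;> cases r <;> rfl

/-- The product of the weights of `x` and `y`, provided that the six points are distinct and the
triangle `abc` is listed in increasing order. -/
def weightProd {α : Type*} [LinearOrder α] (o : α → α → α → Bool) (a b c d x y : α) : ℤ :=
  if (a < b ∧ b < c) ∧ [a, b, c, d, x, y].Nodup then weight o a b c d x * weight o a b c d y else 0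

theorem sum_weight_block {o : Fin 6 → Fin 6 → Fin 6 → Bool} (ho : IsSignotope o)
    (a b c d x y : Fin 6) (hn : [a, b, c, d, x, y].Nodup)
    (h : (univ.filter fun t : Fin 6 × Fin 6 × Fin 6 => [a, b, c, t.1, t.2.1, t.2.2].Nodup) =
      {(d, x, y), (d, y, x), (x, d, y), (x, y, d), (y, d, x), (y, x, d)}) :
    (∑ d, ∑ x, ∑ y, if [a, b, c, d, x, y].Nodup then
      weight o a b c d x * weight o a b c d y else 0) + 72960 =
    2 * (block (o a b c) (o a b d) (o b c d) (o c a d) (o a b x) (o b c x) (o c a x)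
      (o a b y) (o b c y) (o c a y) (o a d x) (o b d x) (o c d x) (o a d y) (o b d y) (o c d y)
      (o a x y) (o b x y) (o c x y) : ℕ) := by
  have key : (∑ d, ∑ x, ∑ y, if [a, b, c, d, x, y].Nodup then
      weight o a b c d x * weight o a b c d y else 0) =
      ∑ t ∈ univ.filter fun t : Fin 6 × Fin 6 × Fin 6 => [a, b, c, t.1, t.2.1, t.2.2].Nodup,
        weight o a b c t.1 t.2.1 * weight o a b c t.1 t.2.2 := by
    rw [sum_filter, Fintype.sum_prod_type]
    simp only [Fintype.sum_prod_type]
  simp only [List.nodup_cons, List.mem_cons, List.not_mem_nil, not_or, or_false] at hn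
  obtain ⟨⟨-, -, had, hax, hay⟩, ⟨-, hbd, hbx, hby⟩, ⟨hcd, hcx, hcy⟩, ⟨hdx, hdy⟩, hxy, -⟩ := hn
  rw [key, h]
  simp only [sum_insert, mem_insert, mem_singleton, Prod.mk.injEq, hdx, hdy, hxy, Ne.symm hdx,
    Ne.symm hdy, Ne.symm hxy, sum_singleton, not_false_eq_true, and_false, or_self, and_true,
    and_self]
  simp only [block, blockOfDigits, weight, ← agreeDigit_not, ho.swap_right a d x had hax hdx,
    ho.swap_right b d x hbd hbx hdx, ho.swap_right c d x hcd hcx hdx, ho.swap_right a d y had hay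
        hdy,
    ho.swap_right b d y hbd hby hdy, ho.swap_right c d y hcd hcy hdy, ho.swap_right a x y hax hay
        hxy,
    ho.swap_right b x y hbx hby hxy, ho.swap_right c x y hcx hcy hxy, Nat.cast_add,
    shiftedMul_eq (weightEntry_lt _ _ _) (weightEntry_lt _ _ _)]
  ring

theorem IsSignotope.swaps {α : Type*} [LinearOrder α] {o : α → α → α → Bool} (ho : IsSignotope o)
    {i j k : α} (h₁ : i ≠ j) (h₂ : i ≠ k) (h₃ : j ≠ k) :
    o i k j = (!o i j k) ∧ o j i k = (!o i j k) ∧ o k j i = (!o i j k) ∧ o j k i = o i j k ∧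
      o k i j = o i j k := by
  have h := ho.swap_right i j k h₁ h₂ h₃
  have h' := ho.swap_left i j k h₁ h₂ h₃
  have h₆ := ho.swap_right j i k h₁.symm h₃ h₂
  have h₅ := ho.swap_left i k j h₂ h₁ h₃.symm
  have h₄ := ho.swap_right k i j h₂.symm h₃.symm h₁
  simp_all

theorem sum_sorted_triples (H : Fin 6 → Fin 6 → Fin 6 → ℤ) :
    (∑ a, ∑ b, ∑ c, if a < b ∧ b < c then H a b c else 0) =
      H 0 1 2 + H 0 1 3 + H 0 1 4 + H 0 1 5 + H 0 2 3 + H 0 2 4 + H 0 2 5 + H 0 3 4 + H 0 3 5 +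
      H 0 4 5 + H 1 2 3 + H 1 2 4 + H 1 2 5 + H 1 3 4 + H 1 3 5 + H 1 4 5 + H 2 3 4 + H 2 3 5 +
      H 2 4 5 + H 3 4 5 := by
  have h : (univ.filter fun t : Fin 6 × Fin 6 × Fin 6 => t.1 < t.2.1 ∧ t.2.1 < t.2.2) =
      {(0, 1, 2), (0, 1, 3), (0, 2, 3), (1, 2, 3), (0, 1, 4), (0, 2, 4), (1, 2, 4), (0, 3, 4),
      (1, 3, 4), (2, 3, 4), (0, 1, 5), (0, 2, 5), (1, 2, 5), (0, 3, 5), (1, 3, 5), (2, 3, 5),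
      (0, 4, 5), (1, 4, 5), (2, 4, 5), (3, 4, 5)} := by
    decide
  have key : (∑ a, ∑ b, ∑ c, if a < b ∧ b < c then H a b c else 0) =
      ∑ t ∈ univ.filter fun t : Fin 6 × Fin 6 × Fin 6 => t.1 < t.2.1 ∧ t.2.1 < t.2.2,
        H t.1 t.2.1 t.2.2 := by
    rw [sum_filter, Fintype.sum_prod_type]
    simp only [Fintype.sum_prod_type]
  rw [key, h]
  repeat rw [sum_insert (by decide)]
  rw [sum_singleton]
  ring

/-- Whether the images of five increasing indices are convex according to the orientation. -/
def fiveConvex {α : Type*} (o : α → α → α → Bool) (g : Fin 5 → α) : Bool :=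
  convexSigns₅ (o (g 0) (g 1) (g 2)) (o (g 0) (g 1) (g 3)) (o (g 0) (g 2) (g 3))
    (o (g 1) (g 2) (g 3)) (o (g 0) (g 1) (g 4)) (o (g 0) (g 2) (g 4)) (o (g 1) (g 2) (g 4))
    (o (g 0) (g 3) (g 4)) (o (g 1) (g 3) (g 4)) (o (g 2) (g 3) (g 4))

theorem sum_weightProd_le {o : Fin 6 → Fin 6 → Fin 6 → Bool} (ho : IsSignotope o) :
    (∑ a, ∑ b, ∑ c, ∑ d, ∑ x, ∑ y, weightProd o a b c d x y) + 11480 ≤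
      42000 * ∑ z : Fin 6, ((fiveConvex o z.succAbove).toNat : ℤ) := by
  have hc : (∑ z : Fin 6, ((fiveConvex o z.succAbove).toNat : ℤ)) = (convexCount₆
      (o 0 1 2) (o 0 1 3) (o 0 2 3) (o 1 2 3) (o 0 1 4) (o 0 2 4) (o 1 2 4) (o 0 3 4) (o 1 3 4)
      (o 2 3 4) (o 0 1 5) (o 0 2 5) (o 1 2 5) (o 0 3 5) (o 1 3 5) (o 2 3 5) (o 0 4 5) (o 1 4 5)
      (o 2 4 5) (o 3 4 5) : ℕ) := by
    rw [Fin.sum_univ_six]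
    rfl
  have hs : (∑ a, ∑ b, ∑ c, ∑ d, ∑ x, ∑ y, weightProd o a b c d x y) + 20 * 72960 =
      2 * (blockSum
      (o 0 1 2) (o 0 1 3) (o 0 2 3) (o 1 2 3) (o 0 1 4) (o 0 2 4) (o 1 2 4) (o 0 3 4) (o 1 3 4)
      (o 2 3 4) (o 0 1 5) (o 0 2 5) (o 1 2 5) (o 0 3 5) (o 1 3 5) (o 2 3 5) (o 0 4 5) (o 1 4 5)
      (o 2 4 5) (o 3 4 5) : ℕ) := by
    have hw : ∀ a b c, (∑ d, ∑ x, ∑ y, weightProd o a b c d x y) =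
        if a < b ∧ b < c then ∑ d, ∑ x, ∑ y, (if [a, b, c, d, x, y].Nodup then
          weight o a b c d x * weight o a b c d y else 0) else 0 := by
      intro a b c
      by_cases h : a < b ∧ b < c <;> simp only
          [weightProd, h, true_and, false_and, if_true, if_false,
        sum_const_zero]
    simp only [hw]
    rw [sum_sorted_triples]
    have h012 := sum_weight_block ho 0 1 2 3 4 5 (by decide) (by decide)
    have h013 := sum_weight_block ho 0 1 3 2 4 5 (by decide) (by decide)
    have h014 := sum_weight_block ho 0 1 4 2 3 5 (by decide) (by decide)
    have h015 := sum_weight_block ho 0 1 5 2 3 4 (by decide) (by decide)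
    have h023 := sum_weight_block ho 0 2 3 1 4 5 (by decide) (by decide)
    have h024 := sum_weight_block ho 0 2 4 1 3 5 (by decide) (by decide)
    have h025 := sum_weight_block ho 0 2 5 1 3 4 (by decide) (by decide)
    have h034 := sum_weight_block ho 0 3 4 1 2 5 (by decide) (by decide)
    have h035 := sum_weight_block ho 0 3 5 1 2 4 (by decide) (by decide)
    have h045 := sum_weight_block ho 0 4 5 1 2 3 (by decide) (by decide)
    have h123 := sum_weight_block ho 1 2 3 0 4 5 (by decide) (by decide)
    have h124 := sum_weight_block ho 1 2 4 0 3 5 (by decide) (by decide)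
    have h125 := sum_weight_block ho 1 2 5 0 3 4 (by decide) (by decide)
    have h134 := sum_weight_block ho 1 3 4 0 2 5 (by decide) (by decide)
    have h135 := sum_weight_block ho 1 3 5 0 2 4 (by decide) (by decide)
    have h145 := sum_weight_block ho 1 4 5 0 2 3 (by decide) (by decide)
    have h234 := sum_weight_block ho 2 3 4 0 1 5 (by decide) (by decide)
    have h235 := sum_weight_block ho 2 3 5 0 1 4 (by decide) (by decide)
    have h245 := sum_weight_block ho 2 4 5 0 1 3 (by decide) (by decide)
    have h345 := sum_weight_block ho 3 4 5 0 1 2 (by decide) (by decide)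
    have s012 := ho.swaps (i := 0) (j := 1) (k := 2) (by decide) (by decide) (by decide)
    have s013 := ho.swaps (i := 0) (j := 1) (k := 3) (by decide) (by decide) (by decide)
    have s023 := ho.swaps (i := 0) (j := 2) (k := 3) (by decide) (by decide) (by decide)
    have s123 := ho.swaps (i := 1) (j := 2) (k := 3) (by decide) (by decide) (by decide)
    have s014 := ho.swaps (i := 0) (j := 1) (k := 4) (by decide) (by decide) (by decide)
    have s024 := ho.swaps (i := 0) (j := 2) (k := 4) (by decide) (by decide) (by decide)
    have s124 := ho.swaps (i := 1) (j := 2) (k := 4) (by decide) (by decide) (by decide)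
    have s034 := ho.swaps (i := 0) (j := 3) (k := 4) (by decide) (by decide) (by decide)
    have s134 := ho.swaps (i := 1) (j := 3) (k := 4) (by decide) (by decide) (by decide)
    have s234 := ho.swaps (i := 2) (j := 3) (k := 4) (by decide) (by decide) (by decide)
    have s015 := ho.swaps (i := 0) (j := 1) (k := 5) (by decide) (by decide) (by decide)
    have s025 := ho.swaps (i := 0) (j := 2) (k := 5) (by decide) (by decide) (by decide)
    have s125 := ho.swaps (i := 1) (j := 2) (k := 5) (by decide) (by decide) (by decide)
    have s035 := ho.swaps (i := 0) (j := 3) (k := 5) (by decide) (by decide) (by decide)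
    have s135 := ho.swaps (i := 1) (j := 3) (k := 5) (by decide) (by decide) (by decide)
    have s235 := ho.swaps (i := 2) (j := 3) (k := 5) (by decide) (by decide) (by decide)
    have s045 := ho.swaps (i := 0) (j := 4) (k := 5) (by decide) (by decide) (by decide)
    have s145 := ho.swaps (i := 1) (j := 4) (k := 5) (by decide) (by decide) (by decide)
    have s245 := ho.swaps (i := 2) (j := 4) (k := 5) (by decide) (by decide) (by decide)
    have s345 := ho.swaps (i := 3) (j := 4) (k := 5) (by decide) (by decide) (by decide)
    simp only [blockSum, Nat.cast_add]
    simp only [s012, s013, s023, s123, s014, s024, s124, s034, s134, s234, s015, s025, s125, s035,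
        s135, s235, s045, s145, s245, s345] at *
    linarith
  have hl := localBound_eq_true
    (ho.mono 0 1 2 3 (by decide) (by decide) (by decide))
    (ho.mono 0 1 2 4 (by decide) (by decide) (by decide))
    (ho.mono 0 1 3 4 (by decide) (by decide) (by decide))
    (ho.mono 0 2 3 4 (by decide) (by decide) (by decide))
    (ho.mono 1 2 3 4 (by decide) (by decide) (by decide))
    (ho.mono 0 1 2 5 (by decide) (by decide) (by decide))
    (ho.mono 0 1 3 5 (by decide) (by decide) (by decide))
    (ho.mono 0 2 3 5 (by decide) (by decide) (by decide))
    (ho.mono 1 2 3 5 (by decide) (by decide) (by decide))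
    (ho.mono 0 1 4 5 (by decide) (by decide) (by decide))
    (ho.mono 0 2 4 5 (by decide) (by decide) (by decide))
    (ho.mono 1 2 4 5 (by decide) (by decide) (by decide))
    (ho.mono 0 3 4 5 (by decide) (by decide) (by decide))
    (ho.mono 1 3 4 5 (by decide) (by decide) (by decide))
    (ho.mono 2 3 4 5 (by decide) (by decide) (by decide))
  simp only [localBound, Nat.ble_eq] at hl
  zify at hl
  linarith

/-- The sum of `weightProd` over all sextuples of elements of `S`. -/
def weightSum {α : Type*} [LinearOrder α] (o : α → α → α → Bool) (S : Finset α) : ℤ :=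
  ∑ t ∈ S ×ˢ S ×ˢ S ×ˢ S ×ˢ S ×ˢ S, weightProd o t.1 t.2.1 t.2.2.1 t.2.2.2.1 t.2.2.2.2.1 t.2.2.2.2.2

theorem weightProd_comp {α β : Type*} [LinearOrder α] [LinearOrder β] (o : β → β → β → Bool)
    (e : α ↪o β) (a b c d x y : α) :
    weightProd o (e a) (e b) (e c) (e d) (e x) (e y) =
      weightProd (fun i j k => o (e i) (e j) (e k)) a b c d x y := by
  have h : [e a, e b, e c, e d, e x, e y].Nodup ↔ [a, b, c, d, x, y].Nodup :=
    List.nodup_map_iff (l := [a, b, c, d, x, y]) e.injective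
  simp only [weightProd, h, e.lt_iff_lt]
  rfl

theorem weightSum_add_le {α : Type*} [LinearOrder α] {o : α → α → α → Bool} (ho : IsSignotope o)
    (C : Finset α → Prop) [DecidablePred C]
    (hC : ∀ g : Fin 5 ↪o α, fiveConvex o g = true → C (univ.map g.toEmbedding))
    {S : Finset α} (hS : S.card = 6) :
    weightSum o S + 11480 ≤ 42000 * ((S.powersetCard 5).filter C).card := by
  set e : Fin 6 ↪o α := S.orderEmbOfFin hS
  have hmap : univ.map e.toEmbedding = S := S.map_orderEmbOfFin_univ hS
  have h := sum_weightProd_le (ho.comp e)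
  have h₁ : weightSum o S = ∑ a, ∑ b, ∑ c, ∑ d, ∑ x, ∑ y,
      weightProd (fun i j k => o (e i) (e j) (e k)) a b c d x y := by
    rw [weightSum, ← hmap]
    simp only [sum_product, sum_map, RelEmbedding.coe_toEmbedding, weightProd_comp]
  have h₂ : (∑ z : Fin 6, ((fiveConvex (fun i j k => o (e i) (e j) (e k)) z.succAbove).toNat : ℤ)) ≤
      ((S.powersetCard 5).filter C).card := by
    have h₃ : (∑ z : Fin 6, ((fiveConvex (fun i j k => o (e i) (e j) (e k)) z.succAbove).toNat :
        ℤ)) =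
        (univ.filter fun z : Fin 6 =>
          fiveConvex (fun i j k => o (e i) (e j) (e k)) z.succAbove = true).card := by
      rw [card_filter]
      push_cast
      refine sum_congr rfl fun z _ => ?_
      cases fiveConvex (fun i j k => o (e i) (e j) (e k)) z.succAbove <;> rfl
    rw [h₃]
    norm_cast
    refine card_le_card_of_injOn (fun z => univ.map ((Fin.succAboveOrderEmb z).trans e).toEmbedding)
      (fun z hz => ?_) (fun z _ w _ hzw => ?_)
    · simp only [coe_filter, mem_univ, true_and, Set.mem_ofPred_eq, mem_powersetCard] at hz ⊢
      refine ⟨⟨fun x hx => ?_, by simp⟩, hC _ hz⟩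
      rw [← hmap]
      simp only [mem_map, mem_univ, true_and] at hx ⊢
      obtain ⟨i, rfl⟩ := hx
      exact ⟨_, rfl⟩
    · by_contra hne
      obtain ⟨i, hi⟩ := Fin.exists_succAbove_eq (Ne.symm hne)
      have hm : e w ∈ univ.map ((Fin.succAboveOrderEmb z).trans e).toEmbedding := by
        simp only [mem_map, mem_univ, true_and]
        exact ⟨i, congrArg e hi⟩
      rw [show univ.map ((Fin.succAboveOrderEmb z).trans e).toEmbedding =
        univ.map ((Fin.succAboveOrderEmb w).trans e).toEmbedding from hzw] at hm
      simp only [mem_map, mem_univ, true_and] at hm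
      obtain ⟨j, hj⟩ := hm
      exact Fin.succAbove_ne w j (e.injective hj)
  linarith

theorem sum_weightSum {α : Type*} [LinearOrder α] [Fintype α] (o : α → α → α → Bool) :
    ∑ S ∈ univ.powersetCard 6, weightSum o S = weightSum o univ := by
  classical
  have h : ∀ S : Finset α, weightSum o S = ∑ t : α × α × α × α × α × α,
      if ({t.1, t.2.1, t.2.2.1, t.2.2.2.1, t.2.2.2.2.1, t.2.2.2.2.2} : Finset α) ⊆ S then
        weightProd o t.1 t.2.1 t.2.2.1 t.2.2.2.1 t.2.2.2.2.1 t.2.2.2.2.2 else 0 := by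
    intro S
    rw [← sum_filter, weightSum]
    refine sum_congr ?_ fun _ _ => rfl
    ext t
    simp [insert_subset_iff]
  simp only [h]
  rw [sum_comm]
  refine sum_congr rfl fun t _ => ?_
  simp only [subset_univ, if_true]
  rw [← sum_filter, sum_const]
  by_cases hn : [t.1, t.2.1, t.2.2.1, t.2.2.2.1, t.2.2.2.2.1, t.2.2.2.2.2].Nodup
  · have hcard := List.toFinset_card_of_nodup hn
    simp only [List.toFinset_cons, List.toFinset_nil, List.length_cons, List.length_nil] at hcard
    rw [show (univ.powersetCard 6).filter (fun S =>
      ({t.1, t.2.1, t.2.2.1, t.2.2.2.1, t.2.2.2.2.1, t.2.2.2.2.2} : Finset α) ⊆ S) =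
      {{t.1, t.2.1, t.2.2.1, t.2.2.2.1, t.2.2.2.2.1, t.2.2.2.2.2}} from ?_, card_singleton,
          one_smul]
    ext S
    simp only [mem_filter, mem_powersetCard, subset_univ, true_and, mem_singleton]
    constructor
    · rintro ⟨h₁, h₂⟩
      exact (eq_of_subset_of_card_le h₂ (by rw [h₁]; exact hcard.ge)).symm
    · rintro rfl
      exact ⟨hcard, Subset.rfl⟩
  · simp [weightProd, hn]

theorem weightSum_univ_ge {n : ℕ} (o : Fin n → Fin n → Fin n → Bool) :
    -(4096 * (n : ℤ) ^ 5) ≤ weightSum o univ := by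
  have h : ∀ a b c d : Fin n, -(4096 * (n : ℤ)) ≤ ∑ x, ∑ y, weightProd o a b c d x y := by
    intro a b c d
    set f : Fin n → ℤ := fun x =>
      if (a < b ∧ b < c) ∧ [a, b, c, d, x].Nodup then weight o a b c d x else 0
    have hf : ∀ x, f x ^ 2 ≤ 4096 := by
      intro x
      simp only [f]
      split_ifs
      · exact weight_sq_le o a b c d x
      · norm_num
    have hw : ∀ x y, weightProd o a b c d x y = f x * f y - if x = y then f x ^ 2 else 0 := by
      intro x y
      simp only [weightProd, f]
      by_cases hxy : x = y
      · subst hxy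
        have : ¬ [a, b, c, d, x, x].Nodup := by simp
        simp only [this, and_false, if_false, if_true, sq, sub_self]
      · have : [a, b, c, d, x, y].Nodup ↔ [a, b, c, d, x].Nodup ∧ [a, b, c, d, y].Nodup := by
          simp only [List.nodup_cons, List.mem_cons, List.not_mem_nil, not_or]
          tauto
        by_cases h₁ : a < b ∧ b < c <;> by_cases h₂ : [a, b, c, d, x].Nodup <;>
          by_cases h₃ : [a, b, c, d, y].Nodup <;> simp only
              [this, h₁, h₂, h₃, hxy, if_true, if_false,
            and_self, and_true, and_false, mul_zero, zero_mul, sub_zero]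
    have hs : ∑ x, ∑ y, weightProd o a b c d x y = (∑ x, f x) ^ 2 - ∑ x, f x ^ 2 := by
      simp only [hw, sum_sub_distrib, sum_ite_eq, mem_univ, if_true, sq (∑ x, f x), sum_mul_sum]
    have hb : ∑ x, f x ^ 2 ≤ ∑ _x : Fin n, 4096 := sum_le_sum fun x _ => hf x
    simp only [sum_const, card_univ, Fintype.card_fin, nsmul_eq_mul] at hb
    rw [hs]
    nlinarith [sq_nonneg (∑ x, f x)]
  have h' : weightSum o univ = ∑ a, ∑ b, ∑ c, ∑ d, ∑ x, ∑ y, weightProd o a b c d x y := by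
    simp only [weightSum, sum_product]
  rw [h']
  calc -(4096 * (n : ℤ) ^ 5) = ∑ _a : Fin n, ∑ _b : Fin n, ∑ _c : Fin n, ∑ _d : Fin n,
        -(4096 * (n : ℤ)) := by
        simp only [sum_const, card_univ, Fintype.card_fin, nsmul_eq_mul]
        ring
    _ ≤ ∑ a, ∑ b, ∑ c, ∑ d, ∑ x, ∑ y, weightProd o a b c d x y := by
        gcongr with a _ b _ c _ d
        exact h a b c d

theorem sum_card_filter_powersetCard_le {n : ℕ} (C : Finset (Fin n) → Prop) [DecidablePred C] :
    ∑ S ∈ univ.powersetCard 6, ((S.powersetCard 5).filter C).card ≤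
      n * ((univ.powersetCard 5).filter C).card := by
  have h : ∀ S : Finset (Fin n), ((S.powersetCard 5).filter C).card =
      ∑ T ∈ (univ.powersetCard 5).filter C, if T ⊆ S then 1 else 0 := by
    intro S
    rw [← card_filter]
    congr 1
    ext T
    simp only [mem_filter, mem_powersetCard, subset_univ, true_and]
    tauto
  rw [sum_congr rfl fun S _ => h S, sum_comm, mul_comm, ← smul_eq_mul]
  refine sum_le_card_nsmul _ _ n fun T hT => ?_
  rw [← card_filter]
  simp only [mem_filter, mem_powersetCard, subset_univ, true_and] at hT
  calc _ ≤ (univ.image fun z : Fin n => insert z T).card := by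
        refine card_le_card fun S hS => ?_
        simp only [mem_filter, mem_powersetCard, subset_univ, true_and] at hS
        obtain ⟨z, hz⟩ := card_eq_one.1 (show (S \ T).card = 1 by
          rw [card_sdiff_of_subset hS.2, hS.1, hT.1])
        refine mem_image.2 ⟨z, mem_univ _, ?_⟩
        rw [insert_eq, ← hz, sdiff_union_of_subset hS.2]
    _ ≤ n := card_image_le.trans (by simp)

theorem choose_six_le_card_convex {n : ℕ} {o : Fin n → Fin n → Fin n → Bool} (ho : IsSignotope o)
    (C : Finset (Fin n) → Prop) [DecidablePred C]
    (hC : ∀ g : Fin 5 ↪o Fin n, fiveConvex o g = true → C (univ.map g.toEmbedding)) :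
    11480 * n.choose 6 ≤ 42000 * (n * ((univ.powersetCard 5).filter C).card) + 4096 * n ^ 5 := by
  have h₁ : ∑ S ∈ (univ : Finset (Fin n)).powersetCard 6, (weightSum o S + 11480) ≤
      ∑ S ∈ univ.powersetCard 6, 42000 * (((S.powersetCard 5).filter C).card : ℤ) :=
    sum_le_sum fun S hS => weightSum_add_le ho C hC (mem_powersetCard.1 hS).2
  rw [sum_add_distrib, sum_weightSum, sum_const, card_powersetCard, card_univ, Fintype.card_fin,
    ← mul_sum, nsmul_eq_mul] at h₁
  have h₂ := sum_card_filter_powersetCard_le C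
  have h₃ := weightSum_univ_ge o
  zify at h₂ ⊢
  linarith

/-- Twice the signed area of the triangle `pqr`. -/
def det3 (p q r : ℝ × ℝ) : ℝ :=
  (q.1 - p.1) * (r.2 - p.2) - (q.2 - p.2) * (r.1 - p.1)

theorem collinear_iff_det3_eq_zero (p q r : ℝ × ℝ) :
    Collinear ℝ ({p, q, r} : Set (ℝ × ℝ)) ↔ det3 p q r = 0 := by
  rw [collinear_iff_of_mem (p₀ := p) (by simp)]
  constructor
  · rintro ⟨v, hv⟩
    obtain ⟨s, hs⟩ := hv q (by simp)
    obtain ⟨t, ht⟩ := hv r (by simp)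
    simp only [hs, ht, det3, vadd_eq_add, Prod.fst_add, Prod.snd_add, Prod.smul_fst, Prod.smul_snd,
      smul_eq_mul]
    ring
  · intro h
    unfold det3 at h
    have key : ∀ v : ℝ × ℝ, (∃ s : ℝ, q = s • v + p) → (∃ s : ℝ, r = s • v + p) →
        ∃ v : ℝ × ℝ, ∀ x ∈ ({p, q, r} : Set (ℝ × ℝ)), ∃ s : ℝ, x = s • v +ᵥ p := by
      intro v hq hr
      refine ⟨v, fun x hx => ?_⟩
      rcases hx with rfl | rfl | rfl
      · exact ⟨0, by simp⟩
      · exact hq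
      · exact hr
    by_cases h₁ : q.1 - p.1 = 0
    · by_cases h₂ : q.2 - p.2 = 0
      · refine key (r - p) ⟨0, ?_⟩ ⟨1, by simp⟩
        ext
        · simpa using sub_eq_zero.1 h₁
        · simpa using sub_eq_zero.1 h₂
      · refine key (q - p) ⟨1, by simp⟩ ⟨(r.2 - p.2) / (q.2 - p.2), ?_⟩
        ext
        · simp only [Prod.fst_add, Prod.smul_fst, Prod.fst_sub, smul_eq_mul]
          field_simp
          linarith
        · simp only [Prod.snd_add, Prod.smul_snd, Prod.snd_sub, smul_eq_mul]
          field_simp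
          ring
    · refine key (q - p) ⟨1, by simp⟩ ⟨(r.1 - p.1) / (q.1 - p.1), ?_⟩
      ext
      · simp only [Prod.fst_add, Prod.smul_fst, Prod.fst_sub, smul_eq_mul]
        field_simp
        ring
      · simp only [Prod.snd_add, Prod.smul_snd, Prod.snd_sub, smul_eq_mul]
        field_simp
        linarith

theorem GenPos.det3_ne_zero {P : Finset (ℝ × ℝ)} (hP : GenPos P) {p q r : ℝ × ℝ} (hp : p ∈ P)
    (hq : q ∈ P) (hr : r ∈ P) (h₁ : p ≠ q) (h₂ : p ≠ r) (h₃ : q ≠ r) : det3 p q r ≠ 0 :=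
  fun h => hP p hp q hq r hr h₁ h₂ h₃ ((collinear_iff_det3_eq_zero p q r).2 h)

/-- Three vectors of a closed half-plane are not arranged cyclically. -/
theorem not_cyclic_of_nonneg {a b c d e f : ℝ} (ha : 0 ≤ a) (hc : 0 ≤ c) (he : 0 ≤ e)
    (h₁ : 0 < a * d - b * c) (h₂ : a * f - b * e < 0) (h₃ : 0 < c * f - d * e) : False := by
  have h : a * (c * f - d * e) + c * (b * e - a * f) + e * (a * d - b * c) = 0 := by ring
  have h₄ := mul_nonneg ha h₃.le
  have h₅ := mul_nonneg hc (show 0 ≤ b * e - a * f by linarith)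
  have h₆ := mul_nonneg he h₁.le
  have h₇ : a = 0 := by
    have : a * (c * f - d * e) = 0 := by linarith
    exact (mul_eq_zero.1 this).resolve_right h₃.ne'
  have h₈ : c = 0 := by
    have : c * (b * e - a * f) = 0 := by linarith
    exact (mul_eq_zero.1 this).resolve_right (by linarith)
  simp [h₇, h₈] at h₁

theorem not_cyclic_of_nonneg' {a b c d e f : ℝ} (ha : 0 ≤ a) (hc : 0 ≤ c) (he : 0 ≤ e)
    (h₁ : a * d - b * c < 0) (h₂ : 0 < a * f - b * e) (h₃ : c * f - d * e < 0) : False :=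
  not_cyclic_of_nonneg (b := -b) (d := -d) (f := -f) ha hc he (by linarith) (by linarith)
    (by linarith)

/-- Whether the triangle `pqr` is oriented counterclockwise. -/
noncomputable def orient (p q r : ℝ × ℝ) : Bool := decide (0 < det3 p q r)

theorem monoSigns_orient {a b c d : ℝ × ℝ} (hab : a.1 ≤ b.1) (hbc : b.1 ≤ c.1) (hcd : c.1 ≤ d.1)
    (h₁ : det3 a b c ≠ 0) (h₂ : det3 a b d ≠ 0) (h₃ : det3 a c d ≠ 0) (h₄ : det3 b c d ≠ 0) :
    monoSigns (orient a b c) (orient a b d) (orient a c d) (orient b c d) = true := by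
  have ab := sub_nonneg.2 hab
  have bc := sub_nonneg.2 hbc
  have cd := sub_nonneg.2 hcd
  have ac := sub_nonneg.2 (hab.trans hbc)
  have bd := sub_nonneg.2 (hbc.trans hcd)
  have ad := sub_nonneg.2 (hab.trans (hbc.trans hcd))
  have ka := not_cyclic_of_nonneg (b := b.2 - a.2) (d := c.2 - a.2) (f := d.2 - a.2) ab ac ad
  have kb := not_cyclic_of_nonneg (b := b.2 - a.2) (d := c.2 - b.2) (f := d.2 - b.2) ab bc bd
  have kc := not_cyclic_of_nonneg (b := c.2 - a.2) (d := c.2 - b.2) (f := d.2 - c.2) ac bc cd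
  have kd := not_cyclic_of_nonneg (b := d.2 - a.2) (d := d.2 - b.2) (f := d.2 - c.2) ad bd cd
  have la := not_cyclic_of_nonneg' (b := b.2 - a.2) (d := c.2 - a.2) (f := d.2 - a.2) ab ac ad
  have lb := not_cyclic_of_nonneg' (b := b.2 - a.2) (d := c.2 - b.2) (f := d.2 - b.2) ab bc bd
  have lc := not_cyclic_of_nonneg' (b := c.2 - a.2) (d := c.2 - b.2) (f := d.2 - c.2) ac bc cd
  unfold orient
  rcases lt_or_gt_of_ne h₁ with h₁ | h₁ <;> rcases lt_or_gt_of_ne h₂ with h₂ | h₂ <;>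
    rcases lt_or_gt_of_ne h₃ with h₃ | h₃ <;> rcases lt_or_gt_of_ne h₄ with h₄ | h₄ <;>
    first
    | (simp only [h₁, h₂, h₃, h₄, h₁.not_gt, h₂.not_gt, h₃.not_gt, h₄.not_gt, decide_true,
        decide_false]; rfl)
    | (exfalso
       unfold det3 at h₁ h₂ h₃ h₄
       first
       | exact ka (by linarith) (by linarith) (by linarith)
       | exact kb (by linarith) (by linarith) (by linarith)
       | exact kc (by linarith) (by linarith) (by linarith)
       | exact kd (by linarith) (by linarith) (by linarith)
       | exact la (by linarith) (by linarith) (by linarith)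
       | exact lb (by linarith) (by linarith) (by linarith)
       | exact lc (by linarith) (by linarith) (by linarith))

/-- A point which strictly minimizes a linear functional on `S` is an extreme point of the hull. -/
theorem mem_extremePoints_of_forall_pos {S : Set (ℝ × ℝ)} {x : ℝ × ℝ} (hx : x ∈ S) (α β : ℝ)
    (h : ∀ y ∈ S, y ≠ x → 0 < α * (y.1 - x.1) + β * (y.2 - x.2)) :
    x ∈ Set.extremePoints ℝ (convexHull ℝ S) := by
  set f : ℝ × ℝ → ℝ := fun y => α * (y.1 - x.1) + β * (y.2 - x.2) with hf
  have hcomb : ∀ (y z : ℝ × ℝ) (s t : ℝ), s + t = 1 → f (s • y + t • z) = s * f y + t * f z := by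
    intro y z s t hst
    obtain rfl : t = 1 - s := by linarith
    simp only [hf, Prod.fst_add, Prod.snd_add, Prod.smul_fst, Prod.smul_snd, smul_eq_mul]
    ring
  have hfx : f x = 0 := by simp [hf]
  have hsub : convexHull ℝ S ⊆ {y | y = x ∨ 0 < f y} := by
    refine convexHull_min (fun y hy => or_iff_not_imp_left.2 (h y hy)) ?_
    intro y hy z hz s t hs ht hst
    rcases hs.eq_or_lt with rfl | hs
    · obtain rfl : t = 1 := by linarith
      simpa using hz
    rcases ht.eq_or_lt with rfl | ht
    · obtain rfl : s = 1 := by linarith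
      simpa using hy
    rcases hy with rfl | hy <;> rcases hz with rfl | hz
    · exact Or.inl (Convex.combo_self hst _)
    · right
      rw [hcomb _ _ _ _ hst, hfx]
      have := mul_pos ht hz
      linarith
    · right
      rw [hcomb _ _ _ _ hst, hfx]
      have := mul_pos hs hy
      linarith
    · right
      rw [hcomb _ _ _ _ hst]
      have := mul_pos hs hy
      have := mul_pos ht hz
      linarith
  refine ⟨subset_convexHull ℝ S hx, ?_⟩
  rintro y hy z hz ⟨s, t, hs, ht, hst, hxyz⟩
  have h₁ := hcomb y z s t hst
  rw [hxyz, hfx] at h₁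
  have hnn : ∀ w ∈ convexHull ℝ S, 0 ≤ f w := by
    intro w hw
    rcases hsub hw with rfl | hw
    · exact hfx.ge
    · exact hw.le
  rcases hsub hy with hy' | hy'
  · exact hy'
  · have := mul_pos hs hy'
    have := mul_nonneg ht.le (hnn z hz)
    linarith

theorem mem_extremePoints_of_det3_pos {S : Set (ℝ × ℝ)} {a b c d e : ℝ × ℝ}
    (hS : S = {a, b, c, d, e}) (habc : 0 < det3 a b c) (habd : 0 < det3 a b d)
    (habe : 0 < det3 a b e) (hace : 0 < det3 a c e) (hade : 0 < det3 a d e) :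
    a ∈ Set.extremePoints ℝ (convexHull ℝ S) := by
  subst hS
  refine mem_extremePoints_of_forall_pos (by simp) ((e.2 - a.2) - (b.2 - a.2))
    ((b.1 - a.1) - (e.1 - a.1)) fun y hy hya => ?_
  simp only [Set.mem_insert_iff, Set.mem_singleton_iff] at hy
  unfold det3 at *
  rcases hy with rfl | rfl | rfl | rfl | rfl
  · exact absurd rfl hya
  all_goals linarith

theorem convexPos_of_det3_pos {S : Finset (ℝ × ℝ)} {a b c d e : ℝ × ℝ}
    (hS : S = {a, b, c, d, e}) (habc : 0 < det3 a b c) (habd : 0 < det3 a b d)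
    (habe : 0 < det3 a b e) (hacd : 0 < det3 a c d) (hace : 0 < det3 a c e) (hade : 0 < det3 a d e)
    (hbcd : 0 < det3 b c d) (hbce : 0 < det3 b c e) (hbde : 0 < det3 b d e)
    (hcde : 0 < det3 c d e) : ConvexPos S := by
  have hrot : ∀ p q r, det3 p q r = det3 q r p := fun p q r => by unfold det3; ring
  have hS' : (S : Set (ℝ × ℝ)) = {a, b, c, d, e} := by simp [hS]
  intro x hx
  simp only [hS, mem_insert, mem_singleton] at hx
  rcases hx with rfl | rfl | rfl | rfl | rfl
  · exact mem_extremePoints_of_det3_pos hS' habc habd habe hace hade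
  · refine mem_extremePoints_of_det3_pos (b := c) (c := d) (d := e) (e := a)
      (hS'.trans ?_) hbcd hbce ?_ ?_ ?_
    · ext; simp; tauto
    all_goals rwa [← hrot]
  · refine mem_extremePoints_of_det3_pos (b := d) (c := e) (d := a) (e := b)
      (hS'.trans ?_) hcde ?_ ?_ ?_ ?_
    · ext; simp; tauto
    all_goals first | rwa [← hrot] | rwa [hrot]
  · refine mem_extremePoints_of_det3_pos (b := e) (c := a) (d := b) (e := c)
      (hS'.trans ?_) ?_ ?_ ?_ ?_ ?_
    · ext; simp; tauto
    all_goals first | rwa [← hrot] | rwa [hrot]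
  · refine mem_extremePoints_of_det3_pos (b := a) (c := b) (d := c) (e := d)
      (hS'.trans ?_) ?_ ?_ ?_ ?_ ?_
    · ext; simp; tauto
    all_goals first | rwa [← hrot] | rwa [hrot]

theorem convexPos_of_fiveConvex {p : Fin 5 → ℝ × ℝ}
    (hp : ∀ i j k, i ≠ j → i ≠ k → j ≠ k → det3 (p i) (p j) (p k) ≠ 0)
    (h : fiveConvex (fun i j k => orient (p i) (p j) (p k)) id = true)
    {S : Finset (ℝ × ℝ)} (hS : S = {p 0, p 1, p 2, p 3, p 4}) : ConvexPos S := by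
  have hneg : ∀ i j k, i ≠ j → i ≠ k → j ≠ k → orient (p i) (p j) (p k) = false →
      det3 (p i) (p j) (p k) < 0 := fun i j k h₁ h₂ h₃ h₄ =>
    lt_of_le_of_ne (not_lt.1 (of_decide_eq_false h₄)) (hp i j k h₁ h₂ h₃)
  have hpos : ∀ i j k, orient (p i) (p j) (p k) = true → 0 < det3 (p i) (p j) (p k) :=
    fun i j k h₄ => of_decide_eq_true h₄
  simp only [fiveConvex, convexSigns₅, convexSigns, id, Bool.and_eq_true, beq_iff_eq] at h
  obtain ⟨⟨⟨⟨⟨e₁, e₂⟩, e₃, e₄⟩, e₅, e₆⟩, e₇, e₈⟩, e₉, e₁₀⟩ := h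
  have key : ∀ b : Bool, ∀ i j k, i ≠ j → i ≠ k → j ≠ k → orient (p i) (p j) (p k) = b →
      0 < (bif b then 1 else -1) * det3 (p i) (p j) (p k) := by
    rintro (_ | _) i j k h₁ h₂ h₃ h₄
    · simpa using hneg i j k h₁ h₂ h₃ h₄
    · simpa using hpos i j k h₄
  have d012 := key (orient (p 0) (p 1) (p 2)) 0 1 2 (by decide) (by decide) (by decide) rfl
  have d013 := key (orient (p 0) (p 1) (p 2)) 0 1 3 (by decide) (by decide) (by decide)
      (by simp_all only)
  have d014 := key (orient (p 0) (p 1) (p 2)) 0 1 4 (by decide) (by decide) (by decide)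
      (by simp_all only)
  have d023 := key (orient (p 1) (p 2) (p 3)) 0 2 3 (by decide) (by decide) (by decide)
      (by simp_all only)
  have d123 := key (orient (p 1) (p 2) (p 3)) 1 2 3 (by decide) (by decide) (by decide) rfl
  have d024 := key (orient (p 1) (p 2) (p 3)) 0 2 4 (by decide) (by decide) (by decide)
      (by simp_all only)
  have d124 := key (orient (p 1) (p 2) (p 3)) 1 2 4 (by decide) (by decide) (by decide)
      (by simp_all only)
  have d034 := key (orient (p 2) (p 3) (p 4)) 0 3 4 (by decide) (by decide) (by decide)
      (by simp_all only)
  have d134 := key (orient (p 2) (p 3) (p 4)) 1 3 4 (by decide) (by decide) (by decide)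
      (by simp_all only)
  have d234 := key (orient (p 2) (p 3) (p 4)) 2 3 4 (by decide) (by decide) (by decide) rfl
  clear e₁ e₂ e₃ e₄ e₅ e₆ e₇ e₈ e₉ e₁₀ key hneg hpos
  generalize orient (p 0) (p 1) (p 2) = A at *
  generalize orient (p 1) (p 2) (p 3) = B at *
  generalize orient (p 2) (p 3) (p 4) = C at *
  unfold det3 at *
  cases A <;> cases B <;> cases C <;> simp only [cond_true, cond_false, one_mul, neg_one_mul] at *
  · refine convexPos_of_det3_pos (a := p 0) (b := p 4) (c := p 3) (d := p 2) (e := p 1)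
      (hS.trans (by ext; simp; try tauto)) ?_ ?_ ?_ ?_ ?_ ?_ ?_ ?_ ?_ ?_ <;> unfold det3 <;>
          linarith
  · refine convexPos_of_det3_pos (a := p 0) (b := p 3) (c := p 4) (d := p 2) (e := p 1)
      (hS.trans (by ext; simp; try tauto)) ?_ ?_ ?_ ?_ ?_ ?_ ?_ ?_ ?_ ?_ <;> unfold det3 <;>
          linarith
  · refine convexPos_of_det3_pos (a := p 0) (b := p 2) (c := p 4) (d := p 3) (e := p 1)
      (hS.trans (by ext; simp; try tauto)) ?_ ?_ ?_ ?_ ?_ ?_ ?_ ?_ ?_ ?_ <;> unfold det3 <;>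
          linarith
  · refine convexPos_of_det3_pos (a := p 0) (b := p 2) (c := p 3) (d := p 4) (e := p 1)
      (hS.trans (by ext; simp; try tauto)) ?_ ?_ ?_ ?_ ?_ ?_ ?_ ?_ ?_ ?_ <;> unfold det3 <;>
          linarith
  · refine convexPos_of_det3_pos (a := p 0) (b := p 1) (c := p 4) (d := p 3) (e := p 2)
      (hS.trans (by ext; simp; try tauto)) ?_ ?_ ?_ ?_ ?_ ?_ ?_ ?_ ?_ ?_ <;> unfold det3 <;>
          linarith
  · refine convexPos_of_det3_pos (a := p 0) (b := p 1) (c := p 3) (d := p 4) (e := p 2)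
      (hS.trans (by ext; simp; try tauto)) ?_ ?_ ?_ ?_ ?_ ?_ ?_ ?_ ?_ ?_ <;> unfold det3 <;>
          linarith
  · refine convexPos_of_det3_pos (a := p 0) (b := p 1) (c := p 2) (d := p 4) (e := p 3)
      (hS.trans (by ext; simp; try tauto)) ?_ ?_ ?_ ?_ ?_ ?_ ?_ ?_ ?_ ?_ <;> unfold det3 <;>
          linarith
  · refine convexPos_of_det3_pos (a := p 0) (b := p 1) (c := p 2) (d := p 3) (e := p 4)
      (hS.trans (by ext; simp; try tauto)) ?_ ?_ ?_ ?_ ?_ ?_ ?_ ?_ ?_ ?_ <;> unfold det3 <;>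
          linarith

theorem isSignotope_orient {n : ℕ} {P : Finset (ℝ × ℝ)} (hP : GenPos P) (p : Fin n ↪ ℝ × ℝ)
    (hpP : ∀ i, p i ∈ P) (hp : ∀ i j, i ≤ j → (p i).1 ≤ (p j).1) :
    IsSignotope fun i j k => orient (p i) (p j) (p k) := by
  have hne : ∀ i j k, i ≠ j → i ≠ k → j ≠ k → det3 (p i) (p j) (p k) ≠ 0 :=
    fun i j k h₁ h₂ h₃ => hP.det3_ne_zero (hpP i) (hpP j) (hpP k) (p.injective.ne h₁)
      (p.injective.ne h₂) (p.injective.ne h₃)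
  have hneg : ∀ s t : ℝ, s = -t → t ≠ 0 → decide (0 < s) = !decide (0 < t) := by
    rintro s t rfl ht
    rcases lt_or_gt_of_ne ht with h | h <;> simp [h, h.not_gt]
  refine ⟨fun i j k h₁ h₂ h₃ => ?_, fun i j k h₁ h₂ h₃ => ?_, fun i j k l h₁ h₂ h₃ => ?_⟩
  · exact hneg _ _ (by unfold det3; ring) (hne i j k h₁ h₂ h₃)
  · exact hneg _ _ (by unfold det3; ring) (hne i j k h₁ h₂ h₃)
  · exact monoSigns_orient (hp _ _ h₁.le) (hp _ _ h₂.le) (hp _ _ h₃.le)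
      (hne _ _ _ h₁.ne (h₁.trans h₂).ne h₂.ne)
      (hne _ _ _ h₁.ne (h₁.trans (h₂.trans h₃)).ne (h₂.trans h₃).ne)
      (hne _ _ _ (h₁.trans h₂).ne (h₁.trans (h₂.trans h₃)).ne h₃.ne)
      (hne _ _ _ h₂.ne (h₂.trans h₃).ne h₃.ne)

theorem choose_six_le_convexPosCount {P : Finset (ℝ × ℝ)} (hP : GenPos P) :
    11480 * P.card.choose 6 ≤ 42000 * (P.card * convexPosCount P 5) + 4096 * P.card ^ 5 := by
  classical
  set n := P.card with hn
  have hcard : (P.map toLex.toEmbedding).card = n := by rw [card_map]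
  set e : Fin n ↪o ℝ ×ₗ ℝ := (P.map toLex.toEmbedding).orderEmbOfFin hcard with he
  set p : Fin n ↪ ℝ × ℝ := e.toEmbedding.trans ofLex.toEmbedding with hpdef
  have hpP : ∀ i, p i ∈ P := by
    intro i
    obtain ⟨x, hx, hxe⟩ := mem_map.1 (orderEmbOfFin_mem (P.map toLex.toEmbedding) hcard i)
    have : p i = x := congrArg ofLex hxe.symm
    rwa [this]
  have hp : ∀ i j, i ≤ j → (p i).1 ≤ (p j).1 := by
    intro i j hij
    rcases Prod.Lex.le_iff.1 (e.monotone hij) with h | h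
    · exact h.le
    · exact h.1.le
  have hne : ∀ i j k, i ≠ j → i ≠ k → j ≠ k → det3 (p i) (p j) (p k) ≠ 0 :=
    fun i j k h₁ h₂ h₃ => hP.det3_ne_zero (hpP i) (hpP j) (hpP k) (p.injective.ne h₁)
      (p.injective.ne h₂) (p.injective.ne h₃)
  have h := choose_six_le_card_convex (isSignotope_orient hP p hpP hp)
    (fun T => ConvexPos (T.map p)) ?_
  · refine h.trans ?_
    gcongr
    unfold convexPosCount
    refine card_le_card_of_injOn (fun T => T.map p) (fun T hT => ?_) (map_injective p).injOn
    simp only [coe_filter, mem_powersetCard, subset_univ, true_and, Set.mem_ofPred_eq] at hT ⊢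
    refine ⟨⟨fun x hx => ?_, by rw [card_map, hT.1]⟩, hT.2⟩
    obtain ⟨i, -, rfl⟩ := mem_map.1 hx
    exact hpP i
  · intro g hg
    refine convexPos_of_fiveConvex (p := fun i => p (g i)) (fun i j k h₁ h₂ h₃ =>
      hne _ _ _ (g.injective.ne h₁) (g.injective.ne h₂) (g.injective.ne h₃)) hg ?_
    rw [map_map]
    ext x
    simp [Fin.exists_fin_succ, eq_comm]

theorem exists_genPos_card_eq (n : ℕ) : ∃ P : Finset (ℝ × ℝ), GenPos P ∧ P.card = n := by
  have hinj : Function.Injective fun i : ℕ => ((i : ℝ), (i : ℝ) ^ 2) :=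
    fun i j h => Nat.cast_injective (congrArg Prod.fst h)
  refine ⟨(range n).map ⟨_, hinj⟩, ?_, by simp⟩
  intro x hx y hy z hz hxy hxz hyz
  obtain ⟨i, -, rfl⟩ := mem_map.1 hx
  obtain ⟨j, -, rfl⟩ := mem_map.1 hy
  obtain ⟨k, -, rfl⟩ := mem_map.1 hz
  have h₁ : (j : ℝ) - i ≠ 0 := fun h => hxy (by simp [sub_eq_zero.1 h])
  have h₂ : (k : ℝ) - i ≠ 0 := fun h => hxz (by simp [sub_eq_zero.1 h])
  have h₃ : (k : ℝ) - j ≠ 0 := fun h => hyz (by simp [sub_eq_zero.1 h])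
  rw [collinear_iff_det3_eq_zero]
  have : det3 ((i : ℝ), (i : ℝ) ^ 2) ((j : ℝ), (j : ℝ) ^ 2) ((k : ℝ), (k : ℝ) ^ 2) =
      (j - i) * (k - i) * (k - j) := by
    unfold det3
    ring
  exact this.trans_ne (mul_ne_zero (mul_ne_zero h₁ h₂) h₃)

theorem choose_six_le_mu (n : ℕ) :
    11480 * n.choose 6 ≤ 42000 * (n * mu 5 n) + 4096 * n ^ 5 := by
  obtain ⟨P, hP, hn⟩ := exists_genPos_card_eq n
  obtain ⟨Q, hQ, rfl, hm⟩ := Nat.sInf_mem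
    (⟨_, P, hP, hn, rfl⟩ : {m | ∃ P : Finset (ℝ × ℝ), GenPos P ∧ P.card = n ∧
      convexPosCount P 5 = m}.Nonempty)
  unfold mu
  rw [← hm]
  exact choose_six_le_convexPosCount hQ

/-- There exists an absolute constant `C` such that for every `n > C`,
`μ₅(n) ≥ ((5√5 − 11)/480) · n⁵`. -/
theorem mu5_lower_bound :
    ∃ C : ℕ, ∀ n : ℕ, n > C →
      (mu 5 n : ℝ) ≥ ((5 * Real.sqrt 5 - 11) / 480) * (n : ℝ) ^ 5 := by
  refine ⟨100000, fun n hn => ?_⟩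
  have h := choose_six_le_mu n
  have hd : (n - 5) ^ 6 ≤ 720 * n.choose 6 := by
    have := Nat.pow_sub_le_descFactorial n 6
    rw [Nat.descFactorial_eq_factorial_mul_choose] at this
    exact this
  have hn' : (100000 : ℝ) < n := by exact_mod_cast hn
  have hd' : ((n : ℝ) - 5) ^ 6 ≤ 720 * (n.choose 6 : ℝ) := by
    have : (((n - 5 : ℕ) : ℝ)) ^ 6 ≤ 720 * (n.choose 6 : ℝ) := by exact_mod_cast hd
    rwa [Nat.cast_sub (by omega), Nat.cast_ofNat] at this
  have hb : (n : ℝ) ^ 6 - 30 * (n : ℝ) ^ 5 ≤ ((n : ℝ) - 5) ^ 6 := by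
    have := one_add_mul_sub_le_pow (n := 6) (a := 1 - 5 / (n : ℝ)) (by
      have : 5 / (n : ℝ) ≤ 1 := by rw [div_le_one (by linarith)]; linarith
      linarith)
    have h₁ : ((n : ℝ) - 5) ^ 6 = (n : ℝ) ^ 6 * (1 - 5 / (n : ℝ)) ^ 6 := by
      rw [← mul_pow]
      congr 1
      field_simp
    have h₂ : (n : ℝ) ^ 6 - 30 * (n : ℝ) ^ 5 =
        (n : ℝ) ^ 6 * (1 + ((6 : ℕ) : ℝ) * (1 - 5 / (n : ℝ) - 1)) := by
      field_simp
      push_cast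
      ring
    rw [h₁, h₂]
    gcongr
  have hr : (11480 * n.choose 6 : ℝ) ≤ 42000 * (n * mu 5 n) + 4096 * (n : ℝ) ^ 5 := by
    exact_mod_cast h
  have hsqrt : Real.sqrt 5 ≤ 2.23607 := by
    rw [Real.sqrt_le_left (by norm_num)]
    norm_num
  have h₅ : 0 < (n : ℝ) ^ 5 := by positivity
  have hmain : (0.000376 : ℝ) * (n : ℝ) ^ 5 ≤ mu 5 n := by
    have h₆ : (n : ℝ) * (0.000376 * (n : ℝ) ^ 5) ≤ n * mu 5 n := by
      have h₇ : 100000 * (n : ℝ) ^ 5 ≤ (n : ℝ) ^ 6 := by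
        rw [pow_succ' (n : ℝ) 5]
        gcongr
      rw [← mul_assoc, mul_comm (n : ℝ), mul_assoc, ← pow_succ']
      linarith
    exact le_of_mul_le_mul_left h₆ (by linarith)
  refine le_trans ?_ hmain
  gcongr
  linarith
end

section
/- For every k and every n with n − 1 ≥ k, the sequence n ↦ μ_k(n)/C(n,k) is non-decreasing: μ_k(n)/C(n,k) ≥ μ_k(n−1)/C(n−1,k). -/
open Finset

/-- General position passes to subsets. -/
theorem GenPos.subset {P Q : Finset (ℝ × ℝ)} (hP : GenPos P) (hQ : Q ⊆ P) : GenPos Q :=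
  fun x hx y hy z hz => hP x (hQ hx) y (hQ hy) z (hQ hz)

/-- Three distinct points on the parabola `y = x ^ 2` are not collinear. -/
theorem not_collinear_parabola {a b c : ℝ} (hab : a ≠ b) (hac : a ≠ c) (hbc : b ≠ c) :
    ¬ Collinear ℝ ({(a, a ^ 2), (b, b ^ 2), (c, c ^ 2)} : Set (ℝ × ℝ)) := by
  intro h
  rw [collinear_iff_of_mem (p₀ := (a, a ^ 2)) (by simp)] at h
  obtain ⟨v, hv⟩ := h
  obtain ⟨r, hr⟩ := hv (b, b ^ 2) (by simp)
  obtain ⟨s, hs⟩ := hv (c, c ^ 2) (by simp)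
  simp only [vadd_eq_add, Prod.ext_iff, Prod.fst_add, Prod.snd_add, Prod.smul_fst,
    Prod.smul_snd, smul_eq_mul] at hr hs
  obtain ⟨hr1, hr2⟩ := hr
  obtain ⟨hs1, hs2⟩ := hs
  have hprod : (b - a) * (c - a) * (c - b) = 0 := by
    have h1 : b - a = r * v.1 := by linarith
    have h2 : b ^ 2 - a ^ 2 = r * v.2 := by linarith
    have h3 : c - a = s * v.1 := by linarith
    have h4 : c ^ 2 - a ^ 2 = s * v.2 := by linarith
    calc (b - a) * (c - a) * (c - b)
        = (b - a) * (c ^ 2 - a ^ 2) - (c - a) * (b ^ 2 - a ^ 2) := by ring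
      _ = 0 := by rw [h1, h2, h3, h4]; ring
  simp only [mul_eq_zero, sub_eq_zero] at hprod
  rcases hprod with (h | h) | h
  · exact hab h.symm
  · exact hac h.symm
  · exact hbc h.symm

/-- The minimum defining `mu` is attained. -/
theorem exists_convexPosCount_eq_mu (k n : ℕ) :
    ∃ P : Finset (ℝ × ℝ), GenPos P ∧ P.card = n ∧ convexPosCount P k = mu k n := by
  obtain ⟨P, hP, hn⟩ := exists_genPos_card_eq n
  exact Nat.sInf_mem
    (s := {m | ∃ P : Finset (ℝ × ℝ), GenPos P ∧ P.card = n ∧ convexPosCount P k = m})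
    ⟨_, P, hP, hn, rfl⟩

theorem mu_le_convexPosCount {P : Finset (ℝ × ℝ)} (hP : GenPos P) (k : ℕ) :
    mu k P.card ≤ convexPosCount P k :=
  Nat.sInf_le ⟨P, hP, rfl, rfl⟩

open scoped Classical in
/-- Each `k`-subset of `P` in convex position survives the removal of a point of `P`
for exactly `P.card - k` choices of this point. -/
theorem sum_convexPosCount_erase (P : Finset (ℝ × ℝ)) (k : ℕ) :
    ∑ p ∈ P, convexPosCount (P.erase p) k = convexPosCount P k * (P.card - k) := by
  have hcount : ∀ p ∈ P, convexPosCount (P.erase p) k =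
      (((P.powersetCard k).filter fun S => ConvexPos S).filter fun S => p ∉ S).card := by
    intro p _
    unfold convexPosCount
    congr 1
    ext S
    simp only [mem_filter, mem_powersetCard, subset_erase]
    tauto
  rw [sum_congr rfl hcount]
  simp_rw [card_filter _ (filter _ _)]
  rw [sum_comm, convexPosCount, ← smul_eq_mul, ← sum_const]
  refine sum_congr rfl fun S hS => ?_
  obtain ⟨hSP, hSk⟩ := mem_powersetCard.1 (mem_filter.1 hS).1
  rw [← card_filter, filter_notMem_eq_sdiff, card_sdiff_of_subset hSP, hSk]

theorem succ_mul_mu_le (k m : ℕ) : (m + 1) * mu k m ≤ mu k (m + 1) * (m + 1 - k) := by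
  classical
  obtain ⟨P, hP, hn, hmu⟩ := exists_convexPosCount_eq_mu k (m + 1)
  rw [← hmu, ← hn, ← sum_convexPosCount_erase, ← smul_eq_mul, ← sum_const]
  refine sum_le_sum fun p hp => ?_
  have hcard : (P.erase p).card = m := by rw [card_erase_of_mem hp, hn, Nat.add_sub_cancel]
  exact hcard ▸ mu_le_convexPosCount (hP.subset (erase_subset p P)) k

/-- The sequence `n ↦ μ_k(n)/C(n,k)` is non-decreasing. -/
theorem mu_div_choose_monotone (k n : ℕ) (h : n - 1 ≥ k) :
    (mu k n : ℝ) / (n.choose k : ℝ) ≥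
      (mu k (n - 1) : ℝ) / ((n - 1).choose k : ℝ) := by
  cases n with
  | zero => exact le_rfl
  | succ m =>
    rw [Nat.add_sub_cancel] at h ⊢
    have hm : 0 < m.choose k := Nat.choose_pos h
    have hm1 : 0 < (m + 1).choose k := Nat.choose_pos (h.trans m.le_succ)
    rw [ge_iff_le, div_le_div_iff₀ (by exact_mod_cast hm) (by exact_mod_cast hm1)]
    have key : mu k m * (m + 1).choose k ≤ mu k (m + 1) * m.choose k := by
      refine Nat.le_of_mul_le_mul_right ?_ m.succ_pos
      calc mu k m * (m + 1).choose k * (m + 1)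
          = (m + 1) * mu k m * (m + 1).choose k := by ring
        _ ≤ mu k (m + 1) * (m + 1 - k) * (m + 1).choose k :=
            Nat.mul_le_mul_right _ (succ_mul_mu_le k m)
        _ = mu k (m + 1) * ((m + 1).choose k * (m + 1 - k)) := by ring
        _ = mu k (m + 1) * m.choose k * (m + 1) := by
            rw [← Nat.choose_mul_succ_eq, mul_assoc]
    exact_mod_cast key
end

section
/- For any point placement P of n points, the sum over all 3-element subsets T of P of the quantity 4·β_T + 3·γ_T equals 12·C(n,4). -/
open Finset

/-- Double counting of pairs `(T, x)` with `T` a `k`-subset and `x ∉ T`, grouped by `T ∪ {x}`. -/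
lemma sum_powersetCard_sum_sdiff {α M : Type*} [DecidableEq α] [AddCommMonoid M]
    (P : Finset α) (k : ℕ) (w : Finset α → α → M) :
    ∑ T ∈ P.powersetCard k, ∑ x ∈ P \ T, w T x =
      ∑ S ∈ P.powersetCard (k + 1), ∑ x ∈ S, w (S.erase x) x := by
  rw [Finset.sum_sigma', Finset.sum_sigma']
  refine Finset.sum_bij' (fun p _ => ⟨insert p.2 p.1, p.2⟩) (fun p _ => ⟨p.1.erase p.2, p.2⟩)
    ?_ ?_ ?_ ?_ ?_
  · rintro ⟨T, x⟩ h
    simp only [mem_sigma, mem_powersetCard, mem_sdiff] at h ⊢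
    obtain ⟨⟨hT, hk⟩, hx, hxT⟩ := h
    exact ⟨⟨insert_subset hx hT, by rw [card_insert_of_notMem hxT, hk]⟩, mem_insert_self _ _⟩
  · rintro ⟨S, x⟩ h
    simp only [mem_sigma, mem_powersetCard, mem_sdiff] at h ⊢
    obtain ⟨⟨hS, hk⟩, hx⟩ := h
    exact ⟨⟨(erase_subset _ _).trans hS, by rw [card_erase_of_mem hx, hk]; rfl⟩, hS hx,
      notMem_erase _ _⟩
  · rintro ⟨T, x⟩ h
    simp only [mem_sigma, mem_sdiff] at h
    simp [erase_insert h.2.2]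
  · rintro ⟨S, x⟩ h
    simp only [mem_sigma] at h
    simp [insert_erase h.2]
  · rintro ⟨T, x⟩ h
    simp only [mem_sigma, mem_sdiff] at h
    simp [erase_insert h.2.2]

section Convex

variable {E : Type*} [AddCommGroup E] [Module ℝ E]

/-- A convex set contains `x` if some positive multiple of `x` is the matching nonnegative
combination of two of its points. -/
lemma Convex.mem_of_smul_eq {C : Set E} (hC : Convex ℝ C) {x a b : E} (ha : a ∈ C) (hb : b ∈ C)
    {p q : ℝ} (hp : 0 ≤ p) (hq : 0 ≤ q) (hpq : 0 < p + q) (h : (p + q) • x = p • a + q • b) :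
    x ∈ C := by
  have hx : x = (p / (p + q)) • a + (q / (p + q)) • b := by
    rw [div_eq_inv_mul, div_eq_inv_mul, mul_smul, mul_smul, ← smul_add, ← h, smul_smul,
      inv_mul_cancel₀ hpq.ne', one_smul]
  rw [hx]
  exact hC ha hb (by positivity) (by positivity) (by rw [← add_div, div_self hpq.ne'])

lemma mem_convexHull_insert_iff {A : Set E} (hA : A.Nonempty) {x y : E} :
    x ∈ convexHull ℝ (insert y A) ↔
      ∃ a ∈ convexHull ℝ A, ∃ s t : ℝ, 0 ≤ s ∧ 0 ≤ t ∧ s + t = 1 ∧ s • y + t • a = x := by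
  rw [convexHull_insert hA, mem_convexJoin]
  simp [segment]

/-- The anti-exchange property of the convex hull. -/
lemma mem_convexHull_of_mem_convexHull_insert {A : Set E} (hA : A.Nonempty) {x y : E}
    (hxy : x ≠ y) (hx : x ∈ convexHull ℝ (insert y A)) (hy : y ∈ convexHull ℝ (insert x A)) :
    x ∈ convexHull ℝ A := by
  obtain ⟨a, ha, s, t, hs, ht, hst, rfl⟩ := (mem_convexHull_insert_iff hA).1 hx
  obtain ⟨b, hb, u, v, hu, hv, huv, h⟩ := (mem_convexHull_insert_iff hA).1 hy
  have ht0 : 0 < t := by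
    refine ht.lt_of_ne fun h0 => hxy ?_
    obtain rfl : s = 1 := by linarith
    simp [← h0]
  refine (convex_convexHull ℝ A).mem_of_smul_eq ha hb ht (mul_nonneg hs hv)
    (by positivity) ?_
  have h1 : t + s * v = 1 - s * u := by
    linear_combination hst + s * huv
  rw [h1]
  linear_combination (norm := module) (-s) • h

/-- A point of a set that is not extreme in the convex hull lies in the hull of the others. -/
lemma mem_convexHull_of_notMem_extremePoints {A : Set E} (hA : A.Nonempty) {x : E}
    (hx : x ∉ (convexHull ℝ (insert x A)).extremePoints ℝ) : x ∈ convexHull ℝ A := by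
  rw [mem_extremePoints_iff_left] at hx
  push Not at hx
  obtain ⟨y, hy, z, hz, ⟨p, q, hp, hq, hpq, h⟩, hne⟩ :=
    hx (subset_convexHull ℝ _ (Set.mem_insert _ _))
  obtain ⟨a, ha, s, t, hs, ht, hst, rfl⟩ := (mem_convexHull_insert_iff hA).1 hy
  obtain ⟨b, hb, u, v, hu, hv, huv, rfl⟩ := (mem_convexHull_insert_iff hA).1 hz
  have ht0 : 0 < t := by
    refine ht.lt_of_ne fun h0 => hne ?_
    obtain rfl : s = 1 := by linarith
    simp [← h0]
  refine (convex_convexHull ℝ A).mem_of_smul_eq ha hb (mul_nonneg hp.le ht) (mul_nonneg hq.le hv)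
    (by positivity) ?_
  have h1 : p * t + q * v = 1 - p * s - q * u := by
    linear_combination p * hst + q * huv + hpq
  rw [h1]
  linear_combination (norm := module) (-1 : ℝ) • h

end Convex

lemma GenPos.mono {P S : Finset (ℝ × ℝ)} (hP : GenPos P) (h : S ⊆ P) : GenPos S :=
  fun x hx y hy z hz => hP x (h hx) y (h hy) z (h hz)

/-- At most one point of a four-point set in general position is in the hull of the others. -/
lemma GenPos.eq_of_mem_convexHull_erase {S : Finset (ℝ × ℝ)} (hS : GenPos S) (h4 : S.card = 4)
    {x y : ℝ × ℝ} (hxS : x ∈ S) (hyS : y ∈ S)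
    (hx : x ∈ convexHull ℝ (S.erase x : Set (ℝ × ℝ)))
    (hy : y ∈ convexHull ℝ (S.erase y : Set (ℝ × ℝ))) : x = y := by
  by_contra hxy
  have hc : ((S.erase x).erase y).card = 2 := by
    rw [card_erase_of_mem (mem_erase.2 ⟨Ne.symm hxy, hyS⟩), card_erase_of_mem hxS, h4]
  obtain ⟨a, b, hab, hA⟩ := card_eq_two.1 hc
  have ha : a ∈ (S.erase x).erase y := hA ▸ by simp
  have hb : b ∈ (S.erase x).erase y := hA ▸ by simp
  have h1 : S.erase x = insert y {a, b} := by
    rw [← hA, insert_erase (mem_erase.2 ⟨Ne.symm hxy, hyS⟩)]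
  have h2 : S.erase y = insert x {a, b} := by
    rw [← hA, erase_right_comm, insert_erase (mem_erase.2 ⟨hxy, hxS⟩)]
  simp only [mem_erase] at ha hb
  rw [h1] at hx
  rw [h2] at hy
  push_cast at hx hy
  have hmem := mem_convexHull_of_mem_convexHull_insert (Set.insert_nonempty _ _) hxy hx hy
  exact hS x hxS a ha.2.2 b hb.2.2 (Ne.symm ha.2.1) (Ne.symm hb.2.1) hab
    (collinear_insert_of_mem_affineSpan_pair
      (convexHull_subset_affineSpan _ hmem))

open scoped Classical in
/-- The total weight of the four splittings of a four-point set as `T ∪ {x}` is `12`. -/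
lemma GenPos.sum_weight_eq {S : Finset (ℝ × ℝ)} (hS : GenPos S) (h4 : S.card = 4) :
    ∑ x ∈ S, ((if IsBetaPt (S.erase x) x then 4 else 0) +
      (if IsGammaPt (S.erase x) x then 3 else 0)) = 12 := by
  by_cases hc : ConvexPos S
  · rw [Finset.sum_congr rfl (g := fun _ => 3)]
    · simp [h4]
    · intro x hx
      simp [IsBetaPt, IsGammaPt, insert_erase hx, hc]
  · have hc' := hc
    unfold ConvexPos at hc'
    push Not at hc'
    obtain ⟨z, hz, hze⟩ := hc'
    have hzmem : z ∈ convexHull ℝ (S.erase z : Set (ℝ × ℝ)) := by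
      refine mem_convexHull_of_notMem_extremePoints ?_ ?_
      · rw [coe_nonempty, ← card_pos, card_erase_of_mem hz]
        omega
      · rwa [← coe_insert, insert_erase hz]
    rw [Finset.sum_congr rfl (g := fun x => if x = z then 0 else 4)]
    · rw [← add_sum_erase _ _ hz, Finset.sum_congr rfl (g := fun _ => 4)]
      · simp [card_erase_of_mem hz, h4]
      · intro x hx
        simp [(mem_erase.1 hx).1]
    · intro x hx
      simp only [IsBetaPt, IsGammaPt, insert_erase hx, hc, not_false_eq_true, true_and, if_false,
        add_zero]
      by_cases hxz : x = z
      · subst hxz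
        simp only [hzmem, not_true_eq_false, if_false, if_true]
      · have hxn : x ∉ convexHull ℝ (S.erase x : Set (ℝ × ℝ)) :=
          fun h => hxz (hS.eq_of_mem_convexHull_erase h4 hx hz h hzmem)
        simp only [hxn, hxz, not_false_eq_true, if_false, if_true]

/-- For any point placement `P` of `n` points,
`∑_T (4·β_T + 3·γ_T) = 12·C(n,4)`, the sum over all 3-element subsets `T` of `P`. -/
theorem sum_beta_gamma_eq (P : Finset (ℝ × ℝ)) (n : ℕ) (hgp : GenPos P)
    (hcard : P.card = n) :
    ∑ T ∈ P.powersetCard 3, (4 * betaCount P T + 3 * gammaCount P T) =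
      12 * n.choose 4 := by
  classical
  have hw : ∀ T, 4 * betaCount P T + 3 * gammaCount P T =
      ∑ x ∈ P \ T, ((if IsBetaPt T x then 4 else 0) + (if IsGammaPt T x then 3 else 0)) := by
    intro T
    rw [betaCount, gammaCount, Finset.sum_add_distrib, ← Finset.sum_filter, ← Finset.sum_filter,
      Finset.sum_const, Finset.sum_const, smul_eq_mul, smul_eq_mul, mul_comm 4, mul_comm 3]
  simp only [hw]
  rw [sum_powersetCard_sum_sdiff, Finset.sum_congr rfl (g := fun _ => 12)]
  · simp [hcard, mul_comm]
  · intro S hS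
    rw [mem_powersetCard] at hS
    convert (hgp.mono hS.1).sum_weight_eq hS.2
end

section
/- For any point placement P of n points, the sum over all 3-element subsets T of P of β_T equals 3 times the number of 4-element subsets of P that are not in convex position, i.e., equals 3·(C(n,4) − Q(P)) where Q(P) is the number of 4-element subsets of P in convex position. -/
open Finset

/-- The anti-exchange identity: if `a` lies on a segment from `b` to `C`, and `b` on a segment
from `a` to `C`, with `C` convex, then `a = b` or `a ∈ C`. -/
theorem Convex.eq_or_mem_of_mem_segment {E : Type*} [AddCommGroup E] [Module ℝ E] {C : Set E}
    (hC : Convex ℝ C) {a b z w : E} (hz : z ∈ C) (hw : w ∈ C)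
    (ha : a ∈ segment ℝ b z) (hb : b ∈ segment ℝ a w) : a = b ∨ a ∈ C := by
  obtain ⟨p, s, hp, hs, hps, ha⟩ := ha
  obtain ⟨q, t, hq, ht, hqt, hb⟩ := hb
  rcases hs.eq_or_lt with rfl | hs
  · left
    obtain rfl : p = 1 := by linarith
    simpa using ha.symm
  · right
    have hpos : 0 < s + p * t := by positivity
    have h1 : (s + p * t) • a = s • z + (p * t) • w := by
      have hcoef : s + p * t = 1 - p * q := by
        have : t = 1 - q := by linarith
        subst this; linarith
      rw [hcoef, sub_smul, one_smul]
      nth_rewrite 1 [← ha]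
      rw [← hb]
      module
    have h2 : a = (s / (s + p * t)) • z + (p * t / (s + p * t)) • w := by
      rw [div_eq_inv_mul, div_eq_inv_mul, mul_smul, mul_smul, ← smul_add, ← h1,
        inv_smul_smul₀ hpos.ne']
    rw [h2]
    exact hC hz hw (by positivity) (by positivity) (by field_simp)

/-- A point outside a nonempty convex set `C` is an extreme point of the convex join with `C`. -/
theorem mem_extremePoints_convexJoin_singleton {E : Type*} [AddCommGroup E] [Module ℝ E]
    {C : Set E} (hC : Convex ℝ C) (hne : C.Nonempty) {x : E} (hx : x ∉ C) :
    x ∈ Set.extremePoints ℝ (convexJoin ℝ {x} C) := by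
  rw [mem_extremePoints_iff_left]
  refine ⟨subset_convexJoin_left hne rfl, ?_⟩
  intro y hy z hz hxyz
  simp only [convexJoin_singleton_left, Set.mem_iUnion] at hy hz
  obtain ⟨y', hy', p, s, hp, hs, hps, hy⟩ := hy
  obtain ⟨z', hz', q, t, hq, ht, hqt, hz⟩ := hz
  obtain ⟨a, b, ha, hb, hab, hxyz⟩ := hxyz
  rcases hs.eq_or_lt with rfl | hs
  · obtain rfl : p = 1 := by linarith
    simpa using hy.symm
  · exfalso
    apply hx
    have hpos : 0 < a * s + b * t := by positivity
    have h1 : (a * s + b * t) • x = (a * s) • y' + (b * t) • z' := by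
      have hcoef : a * s + b * t = 1 - (a * p + b * q) := by
        have : s = 1 - p := by linarith
        have : t = 1 - q := by linarith
        subst s t; linarith
      rw [hcoef, sub_smul, one_smul]
      nth_rewrite 1 [← hxyz]
      rw [← hy, ← hz]
      module
    have h2 : x = (a * s / (a * s + b * t)) • y' + (b * t / (a * s + b * t)) • z' := by
      rw [div_eq_inv_mul, div_eq_inv_mul, mul_smul _ (a * s), mul_smul _ (b * t), ← smul_add, ← h1,
        inv_smul_smul₀ hpos.ne']
    rw [h2]
    exact hC hy' hz' (by positivity) (by positivity) (by field_simp)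

/-- A point of `S` is an extreme point of the convex hull of `S` if and only if it is not in the
convex hull of the other points. -/
theorem mem_extremePoints_convexHull_iff {E : Type*} [AddCommGroup E] [Module ℝ E]
    {S : Set E} {x : E} (hx : x ∈ S) :
    x ∈ Set.extremePoints ℝ (convexHull ℝ S) ↔ x ∉ convexHull ℝ (S \ {x}) := by
  constructor
  · intro h hmem
    rw [(convex_convexHull ℝ S).mem_extremePoints_iff_mem_sdiff_convexHull_sdiff] at h
    exact h.2 (convexHull_mono (Set.sdiff_subset_sdiff_left (subset_convexHull ℝ S)) hmem)
  · intro h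
    have hS : insert x (S \ {x}) = S := by simp [Set.insert_eq_of_mem hx]
    rcases (S \ {x}).eq_empty_or_nonempty with he | hne
    · rw [← hS, he]
      simp
    · rw [← hS, convexHull_insert hne]
      exact mem_extremePoints_convexJoin_singleton (convex_convexHull ℝ _) hne.convexHull h

theorem convexPos_iff (S : Finset (ℝ × ℝ)) :
    ConvexPos S ↔ ∀ x ∈ S, x ∉ convexHull ℝ ((S.erase x : Finset (ℝ × ℝ)) : Set (ℝ × ℝ)) := by
  refine forall₂_congr fun x hx => ?_
  rw [mem_extremePoints_convexHull_iff (Finset.mem_coe.2 hx), Finset.coe_erase]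

/-- Among four points in general position, at most one lies in the convex hull of the others. -/
theorem GenPos.notMem_convexHull_insert {P : Finset (ℝ × ℝ)} (hP : GenPos P) {a b c d : ℝ × ℝ}
    (ha : a ∈ P) (hc : c ∈ P) (hd : d ∈ P) (hab : a ≠ b) (hac : a ≠ c) (had : a ≠ d)
    (hcd : c ≠ d) (h : a ∈ convexHull ℝ ({b, c, d} : Set (ℝ × ℝ))) :
    b ∉ convexHull ℝ ({a, c, d} : Set (ℝ × ℝ)) := by
  intro h'
  rw [convexHull_insert (Set.insert_nonempty _ _), convexHull_pair, convexJoin_singleton_left,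
    Set.mem_iUnion₂] at h h'
  obtain ⟨z, hz, haz⟩ := h
  obtain ⟨w, hw, hbw⟩ := h'
  rcases (convex_segment c d).eq_or_mem_of_mem_segment hz hw haz hbw with h | h
  · exact hab h
  · refine hP a ha c hc d hd hac had hcd (collinear_insert_of_mem_affineSpan_pair ?_)
    exact (mem_segment_iff_wbtw.1 h).mem_affineSpan

open scoped Classical in
/-- Double counting of pairs `(T, x)` with `x ∉ T` through the set `T ∪ {x}`. -/
theorem sum_card_filter_sdiff_powersetCard {α : Type*} [DecidableEq α] (P : Finset α) (k : ℕ)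
    (r : Finset α → α → Prop) :
    ∑ T ∈ P.powersetCard k, ((P \ T).filter fun x => r T x).card =
      ∑ S ∈ P.powersetCard (k + 1), (S.filter fun x => r (S.erase x) x).card := by
  rw [← Finset.card_sigma, ← Finset.card_sigma]
  refine Finset.card_bij' (fun p _ => ⟨insert p.2 p.1, p.2⟩) (fun p _ => ⟨p.1.erase p.2, p.2⟩)
    ?_ ?_ ?_ ?_
  · rintro ⟨T, x⟩ h
    simp only [mem_sigma, mem_powersetCard, mem_filter, mem_sdiff] at h ⊢
    obtain ⟨⟨hT, hk⟩, ⟨hx, hxT⟩, hr⟩ := h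
    refine ⟨⟨insert_subset hx hT, ?_⟩, mem_insert_self _ _, ?_⟩
    · rw [card_insert_of_notMem hxT, hk]
    · rwa [erase_insert hxT]
  · rintro ⟨S, x⟩ h
    simp only [mem_sigma, mem_powersetCard, mem_filter, mem_sdiff] at h ⊢
    obtain ⟨⟨hS, hk⟩, hx, hr⟩ := h
    refine ⟨⟨(erase_subset _ _).trans hS, ?_⟩, ⟨hS hx, notMem_erase _ _⟩, hr⟩
    rw [card_erase_of_mem hx, hk, Nat.add_sub_cancel]
  · rintro ⟨T, x⟩ h
    simp only [mem_sigma, mem_filter, mem_sdiff] at h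
    simp only [erase_insert h.2.1.2]
  · rintro ⟨S, x⟩ h
    simp only [mem_sigma, mem_filter] at h
    simp only [insert_erase h.2.1]

open scoped Classical in
/-- Four points in general position that are not in convex position yield three β-points. -/
theorem GenPos.card_filter_isBetaPt {P : Finset (ℝ × ℝ)} (hP : GenPos P) {S : Finset (ℝ × ℝ)}
    (hSP : S ⊆ P) (hS : S.card = 4) :
    (S.filter fun x => IsBetaPt (S.erase x) x).card = if ConvexPos S then 0 else 3 := by
  split_ifs with hconv
  · rw [card_eq_zero, filter_eq_empty_iff]
    intro x hx h
    apply h.1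
    convert hconv
    exact insert_erase hx
  · have hex := hconv
    rw [convexPos_iff] at hex
    push Not at hex
    obtain ⟨a, ha, hmem⟩ := hex
    have hfilter : (S.filter fun x => IsBetaPt (S.erase x) x) = S.erase a := by
      ext x
      simp only [mem_filter, mem_erase]
      constructor
      · rintro ⟨hx, hβ⟩
        refine ⟨?_, hx⟩
        rintro rfl
        apply hβ.2
        convert hmem
      · rintro ⟨hxa, hx⟩
        refine ⟨hx, fun h => hconv ?_, fun h => ?_⟩
        · convert h
          exact (insert_erase hx).symm
        · have hcard : ((S.erase a).erase x).card = 2 := by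
            rw [card_erase_of_mem (mem_erase.2 ⟨hxa, hx⟩), card_erase_of_mem ha, hS]
          obtain ⟨c, d, hcd, hD⟩ := card_eq_two.1 hcard
          have hc : c ∈ (S.erase a).erase x := by simp [hD]
          have hd : d ∈ (S.erase a).erase x := by simp [hD]
          simp only [mem_erase] at hc hd
          have h1 : S.erase a = {x, c, d} := by
            rw [← hD, insert_erase (mem_erase.2 ⟨hxa, hx⟩)]
          have h2 : S.erase x = {a, c, d} := by
            rw [← hD, erase_right_comm, insert_erase (mem_erase.2 ⟨hxa.symm, ha⟩)]
          refine hP.notMem_convexHull_insert (hSP ha) (hSP hc.2.2) (hSP hd.2.2) hxa.symm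
            hc.2.1.symm hd.2.1.symm hcd (b := x) ?_ ?_
          · have := congrArg (fun s : Finset (ℝ × ℝ) => (s : Set (ℝ × ℝ))) h1
            push_cast at this hmem
            rwa [this] at hmem
          · have := congrArg (fun s : Finset (ℝ × ℝ) => (s : Set (ℝ × ℝ))) h2
            push_cast at this h
            rwa [this] at h
    rw [hfilter, card_erase_of_mem ha, hS]

/-- For any point placement `P` of `n` points, `∑_T β_T = 3·(C(n,4) − Q(P))`, where
`Q(P)` is the number of 4-element subsets of `P` in convex position. -/
theorem sum_beta_eq (P : Finset (ℝ × ℝ)) (n : ℕ) (hgp : GenPos P)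
    (hcard : P.card = n) :
    ∑ T ∈ P.powersetCard 3, betaCount P T = 3 * (n.choose 4 - convexPosCount P 4) := by
  classical
  unfold betaCount
  rw [sum_card_filter_sdiff_powersetCard P 3 IsBetaPt]
  rw [Finset.sum_congr rfl fun S hS =>
    hgp.card_filter_isBetaPt (mem_powersetCard.1 hS).1 (mem_powersetCard.1 hS).2]
  have hsplit := card_filter_add_card_filter_not (s := P.powersetCard 4) (fun S => ConvexPos S)
  rw [card_powersetCard, hcard] at hsplit
  rw [sum_ite, sum_const_zero, zero_add, sum_const, smul_eq_mul, mul_comm, ← hsplit]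
  unfold convexPosCount
  rw [Nat.add_sub_cancel_left]
end
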